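/- For every D > 0 and every ε > 0 there exists x₀ such that the following holds for all x ≥ x₀: let B₀ be either 1 or a prime with log x ≤ B₀ ≤ x, and set P := (∏_{p ≤ x, p prime} p)/B₀. Then for every real Z ≥ P^{D} and all integers a, b with 1 ≤ a, b ≤ P and a ≠ b, #{z ∈ ℤ : 1 ≤ z ≤ Z and both Pz + a and Pz + b are prime} ≤ (8e^{2γ} + ε)·(log x/log Z)²·Z. -/

import Mathlib

open Real

/-- `primorialBelow x` is the product of all primes `p ≤ x`. -/
noncomputable def primorialBelow (x : ℝ) : ℕ :=
  ∏ p ∈ Finset.filter Nat.Prime (Finset.range (⌊x⌋₊ + 1)), p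

theorem sum_powerset_filter_superset_neg_one_pow {ι : Type*} [DecidableEq ι] {l M : Finset ι}
    (hl : l ⊆ M) :
    ∑ A ∈ M.powerset with l ⊆ A, (-1 : ℝ) ^ A.card = if l = M then (-1 : ℝ) ^ l.card else 0 := by
  have key := Finset.prod_add (fun _ : ι => (-1 : ℝ)) (fun i => if i ∈ l then 0 else 1) M
  have h1 : ∏ i ∈ M, ((-1 : ℝ) + if i ∈ l then 0 else 1) =
      if l = M then (-1 : ℝ) ^ l.card else 0 := by
    split_ifs with h
    · subst h
      rw [Finset.prod_congr rfl (g := fun _ => (-1 : ℝ)) (by intro i hi; simp [hi])]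
      simp
    · obtain ⟨i, hi, hil⟩ := Finset.not_subset.mp (fun h' => h (hl.antisymm h'))
      exact Finset.prod_eq_zero hi (by simp [hil])
  rw [← h1, key, Finset.sum_filter]
  refine Finset.sum_congr rfl fun A hA => ?_
  rw [Finset.mem_powerset] at hA
  split_ifs with h
  · rw [Finset.prod_const, Finset.prod_eq_one, mul_one]
    intro i hi
    rw [Finset.mem_sdiff] at hi
    exact if_neg fun h' => hi.2 (h h')
  · obtain ⟨i, hi, hiA⟩ := Finset.not_subset.mp h
    have hz : (∏ i ∈ M \ A, if i ∈ l then (0 : ℝ) else 1) = 0 :=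
      Finset.prod_eq_zero (Finset.mem_sdiff.2 ⟨hl hi, hiA⟩) (if_pos hi)
    rw [hz, mul_zero]

/-- The optimal weights in Selberg's upper bound sieve, indexed by finite sets of primes. -/
noncomputable def selbergWeight {ι : Type*} [DecidableEq ι] (𝒟 : Finset (Finset ι)) (g : ι → ℝ)
    (A : Finset ι) : ℝ :=
  (-1) ^ A.card / ((∏ i ∈ A, g i) * ∑ M ∈ 𝒟, ∏ i ∈ M, g i / (1 - g i)) *
    ∑ M ∈ 𝒟 with A ⊆ M, ∏ i ∈ M, g i / (1 - g i)

section Selberg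

variable {ι : Type*} {𝒟 : Finset (Finset ι)} {g : ι → ℝ}

theorem selberg_density_pos (hg : ∀ M ∈ 𝒟, ∀ i ∈ M, 0 < g i ∧ g i < 1)
    {M : Finset ι} (hM : M ∈ 𝒟) : 0 < ∏ i ∈ M, g i / (1 - g i) :=
  Finset.prod_pos fun i hi => div_pos (hg M hM i hi).1 (sub_pos.2 (hg M hM i hi).2)

theorem selberg_sum_pos (hg : ∀ M ∈ 𝒟, ∀ i ∈ M, 0 < g i ∧ g i < 1) (h0 : ∅ ∈ 𝒟) :
    0 < ∑ M ∈ 𝒟, ∏ i ∈ M, g i / (1 - g i) :=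
  Finset.sum_pos (fun _ hM => selberg_density_pos hg hM) ⟨∅, h0⟩

variable [DecidableEq ι]

theorem selbergWeight_empty (hg : ∀ M ∈ 𝒟, ∀ i ∈ M, 0 < g i ∧ g i < 1) (h0 : ∅ ∈ 𝒟) :
    selbergWeight 𝒟 g ∅ = 1 := by
  have := (selberg_sum_pos hg h0).ne'
  simp only [selbergWeight, Finset.card_empty, pow_zero, Finset.prod_empty, one_mul,
    Finset.empty_subset, Finset.filter_true]
  field_simp

theorem abs_selbergWeight_le (hg : ∀ M ∈ 𝒟, ∀ i ∈ M, 0 < g i ∧ g i < 1) (h0 : ∅ ∈ 𝒟)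
    (hdown : ∀ M ∈ 𝒟, ∀ A ⊆ M, A ∈ 𝒟) {A : Finset ι} (hA : A ∈ 𝒟) :
    |selbergWeight 𝒟 g A| ≤ ∏ i ∈ A, 1 / (1 - g i) := by
  have hL := selberg_sum_pos hg h0
  have hG : 0 < ∏ i ∈ A, g i := Finset.prod_pos fun i hi => (hg A hA i hi).1
  have hH := selberg_density_pos hg hA
  have hsum : ∑ M ∈ 𝒟 with A ⊆ M, ∏ i ∈ M, g i / (1 - g i) ≤
      (∏ i ∈ A, g i / (1 - g i)) * ∑ M ∈ 𝒟, ∏ i ∈ M, g i / (1 - g i) := by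
    have h1 : ∑ M ∈ 𝒟 with A ⊆ M, ∏ i ∈ M, g i / (1 - g i) =
        (∏ i ∈ A, g i / (1 - g i)) * ∑ M ∈ 𝒟 with A ⊆ M, ∏ i ∈ M \ A, g i / (1 - g i) := by
      rw [Finset.mul_sum]
      refine Finset.sum_congr rfl fun M hM => ?_
      rw [mul_comm, Finset.prod_sdiff (Finset.mem_filter.1 hM).2]
    rw [h1]
    refine mul_le_mul_of_nonneg_left ?_ hH.le
    have hinj : Set.InjOn (fun M : Finset ι => M \ A) (𝒟.filter (A ⊆ ·) : Finset (Finset ι)) := by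
      intro M hM N hN h
      have hM' := (Finset.mem_filter.1 hM).2
      have hN' := (Finset.mem_filter.1 hN).2
      rw [← Finset.sdiff_union_of_subset hM', ← Finset.sdiff_union_of_subset hN']
      exact congrArg (· ∪ A) h
    rw [← Finset.sum_image (f := fun M => ∏ i ∈ M, g i / (1 - g i)) hinj]
    refine Finset.sum_le_sum_of_subset_of_nonneg ?_ fun M hM _ => (selberg_density_pos hg hM).le
    intro N hN
    obtain ⟨M, hM, rfl⟩ := Finset.mem_image.1 hN
    exact hdown M (Finset.mem_filter.1 hM).1 _ Finset.sdiff_subset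
  have hnn : 0 ≤ ∑ M ∈ 𝒟 with A ⊆ M, ∏ i ∈ M, g i / (1 - g i) :=
    Finset.sum_nonneg fun M hM => (selberg_density_pos hg (Finset.mem_filter.1 hM).1).le
  rw [selbergWeight, abs_mul, abs_div, abs_pow, abs_neg, abs_one, one_pow,
    abs_of_pos (mul_pos hG hL), abs_of_nonneg hnn, one_div_mul_eq_div, div_le_iff₀ (mul_pos hG hL)]
  refine hsum.trans (le_of_eq ?_)
  rw [← mul_assoc, ← Finset.prod_mul_distrib]
  congr 1
  exact Finset.prod_congr rfl fun i _ => by ring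

theorem sum_selbergWeight_mul_density (hg : ∀ M ∈ 𝒟, ∀ i ∈ M, 0 < g i ∧ g i < 1)
    (hdown : ∀ M ∈ 𝒟, ∀ A ⊆ M, A ∈ 𝒟) {l : Finset ι} (hl : l ∈ 𝒟) :
    ∑ A ∈ 𝒟 with l ⊆ A, selbergWeight 𝒟 g A * ∏ i ∈ A, g i =
      (-1) ^ l.card * (∏ i ∈ l, g i / (1 - g i)) / ∑ M ∈ 𝒟, ∏ i ∈ M, g i / (1 - g i) := by
  set L := ∑ M ∈ 𝒟, ∏ i ∈ M, g i / (1 - g i) with hLdef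
  have h1 : ∀ A ∈ 𝒟.filter (l ⊆ ·), selbergWeight 𝒟 g A * ∏ i ∈ A, g i =
      ∑ M ∈ 𝒟, if A ⊆ M then (-1) ^ A.card * (∏ i ∈ M, g i / (1 - g i)) / L else 0 := by
    intro A hA
    have hG : 0 < ∏ i ∈ A, g i :=
      Finset.prod_pos fun i hi => (hg A (Finset.mem_filter.1 hA).1 i hi).1
    rw [selbergWeight, ← hLdef, ← Finset.sum_filter, ← Finset.sum_div, ← Finset.mul_sum]
    field_simp
  rw [Finset.sum_congr rfl h1, Finset.sum_comm]
  have h2 : ∀ M ∈ 𝒟, ∑ A ∈ 𝒟.filter (l ⊆ ·),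
      (if A ⊆ M then (-1) ^ A.card * (∏ i ∈ M, g i / (1 - g i)) / L else 0) =
      if M = l then (-1) ^ l.card * (∏ i ∈ l, g i / (1 - g i)) / L else 0 := by
    intro M hM
    rw [← Finset.sum_filter, Finset.filter_filter]
    have hset : 𝒟.filter (fun A => l ⊆ A ∧ A ⊆ M) = M.powerset.filter (l ⊆ ·) := by
      ext A
      simp only [Finset.mem_filter, Finset.mem_powerset]
      exact ⟨fun h => ⟨h.2.2, h.2.1⟩, fun h => ⟨hdown M hM A h.1, h.2, h.1⟩⟩
    rw [hset, ← Finset.sum_div, ← Finset.sum_mul]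
    by_cases hlM : l ⊆ M
    · rw [sum_powerset_filter_superset_neg_one_pow hlM]
      by_cases h : l = M
      · subst h; simp
      · simp [h, Ne.symm h]
    · rw [if_neg (fun h : M = l => hlM h.ge), Finset.filter_false_of_mem]
      · simp
      · intro A hA hlA
        exact hlM (hlA.trans (Finset.mem_powerset.1 hA))
  rw [Finset.sum_congr rfl h2, Finset.sum_ite_eq' 𝒟 l, if_pos hl]

theorem prod_union_eq_sum (hg : ∀ M ∈ 𝒟, ∀ i ∈ M, 0 < g i ∧ g i < 1)
    (hdown : ∀ M ∈ 𝒟, ∀ A ⊆ M, A ∈ 𝒟) {A B : Finset ι} (hA : A ∈ 𝒟) :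
    ∏ i ∈ A ∪ B, g i = ∑ l ∈ 𝒟, if l ⊆ A ∧ l ⊆ B then
      (∏ i ∈ A, g i) * (∏ i ∈ B, g i) / ∏ i ∈ l, g i / (1 - g i) else 0 := by
  have hI : ∏ i ∈ A ∩ B, g i ≠ 0 := Finset.prod_ne_zero_iff.2 fun i hi =>
    (hg A hA i (Finset.mem_inter.1 hi).1).1.ne'
  have h1 : (∏ i ∈ A ∩ B, g i)⁻¹ =
      ∑ l ∈ (A ∩ B).powerset, (∏ i ∈ l, g i / (1 - g i))⁻¹ := by
    simp_rw [← Finset.prod_inv_distrib]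
    rw [← Finset.prod_one_add]
    refine Finset.prod_congr rfl fun i hi => ?_
    have := hg A hA i (Finset.mem_inter.1 hi).1
    have h2 : g i ≠ 0 := this.1.ne'
    have h3 : 1 - g i ≠ 0 := (sub_pos.2 this.2).ne'
    field_simp
    ring
  have h2 : ∏ i ∈ A ∪ B, g i = (∏ i ∈ A, g i) * (∏ i ∈ B, g i) * (∏ i ∈ A ∩ B, g i)⁻¹ := by
    rw [← Finset.prod_union_inter]
    field_simp
  rw [h2, h1, Finset.mul_sum, ← Finset.sum_filter]
  refine Finset.sum_congr ?_ fun l _ => by rw [div_eq_mul_inv]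
  ext l
  simp only [Finset.mem_powerset, Finset.mem_filter, Finset.subset_inter_iff]
  exact ⟨fun h => ⟨hdown A hA l h.1, h⟩, fun h => h.2⟩

theorem selbergWeight_quadratic_form (hg : ∀ M ∈ 𝒟, ∀ i ∈ M, 0 < g i ∧ g i < 1) (h0 : ∅ ∈ 𝒟)
    (hdown : ∀ M ∈ 𝒟, ∀ A ⊆ M, A ∈ 𝒟) :
    ∑ A ∈ 𝒟, ∑ B ∈ 𝒟, selbergWeight 𝒟 g A * selbergWeight 𝒟 g B * ∏ i ∈ A ∪ B, g i =
      (∑ M ∈ 𝒟, ∏ i ∈ M, g i / (1 - g i))⁻¹ := by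
  have hL := selberg_sum_pos hg h0
  have h1 : ∀ A ∈ 𝒟, ∀ B ∈ 𝒟,
      selbergWeight 𝒟 g A * selbergWeight 𝒟 g B * ∏ i ∈ A ∪ B, g i =
      ∑ l ∈ 𝒟, (∏ i ∈ l, g i / (1 - g i))⁻¹ *
        ((if l ⊆ A then selbergWeight 𝒟 g A * ∏ i ∈ A, g i else 0) *
         (if l ⊆ B then selbergWeight 𝒟 g B * ∏ i ∈ B, g i else 0)) := by
    intro A hA B hB
    rw [prod_union_eq_sum hg hdown hA, Finset.mul_sum]
    refine Finset.sum_congr rfl fun l _ => ?_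
    by_cases h : l ⊆ A <;> by_cases h' : l ⊆ B <;> simp [h, h', -Finset.prod_div_distrib]
    ring
  rw [Finset.sum_congr rfl fun A hA => Finset.sum_congr rfl (h1 A hA)]
  rw [Finset.sum_congr rfl fun A _ => Finset.sum_comm, Finset.sum_comm]
  have h2 : ∀ l ∈ 𝒟, ∑ A ∈ 𝒟, ∑ B ∈ 𝒟, (∏ i ∈ l, g i / (1 - g i))⁻¹ *
        ((if l ⊆ A then selbergWeight 𝒟 g A * ∏ i ∈ A, g i else 0) *
         (if l ⊆ B then selbergWeight 𝒟 g B * ∏ i ∈ B, g i else 0)) =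
      (∏ i ∈ l, g i / (1 - g i)) / (∑ M ∈ 𝒟, ∏ i ∈ M, g i / (1 - g i)) ^ 2 := by
    intro l hl
    simp_rw [← Finset.mul_sum]
    rw [← Finset.sum_mul, ← Finset.sum_filter, sum_selbergWeight_mul_density hg hdown hl]
    have hH := (selberg_density_pos hg hl).ne'
    have hs : ((-1 : ℝ) ^ l.card) ^ 2 = 1 := by rw [← pow_mul, mul_comm, pow_mul]; simp
    field_simp
    rw [hs]
  rw [Finset.sum_congr rfl h2, ← Finset.sum_div]
  field_simp

theorem ite_mul_ite_eq (p q : Prop) [Decidable p] [Decidable q] [Decidable (p ∧ q)] (u v : ℝ) :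
    (if p then u else 0) * (if q then v else 0) = u * v * ((if p ∧ q then 1 else 0 : ℕ) : ℝ) := by
  by_cases hp : p <;> by_cases hq : q <;> simp [hp, hq]

/-- Selberg's upper bound sieve. -/
theorem selberg_sieve {α : Type*} (S : Finset α) (P : Finset ι) (E : ι → α → Prop)
    [∀ i z, Decidable (E i z)] (X : ℝ) (r : Finset ι → ℝ)
    (hP : ∀ M ∈ 𝒟, M ⊆ P)
    (hg : ∀ M ∈ 𝒟, ∀ i ∈ M, 0 < g i ∧ g i < 1) (h0 : ∅ ∈ 𝒟)
    (hdown : ∀ M ∈ 𝒟, ∀ A ⊆ M, A ∈ 𝒟)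
    (hr : ∀ A ⊆ P, |((S.filter fun z => ∀ i ∈ A, E i z).card : ℝ) - X * ∏ i ∈ A, g i| ≤ r A) :
    ((S.filter fun z => ∀ i ∈ P, ¬ E i z).card : ℝ) ≤
      X / (∑ M ∈ 𝒟, ∏ i ∈ M, g i / (1 - g i)) +
        ∑ A ∈ 𝒟, ∑ B ∈ 𝒟, |selbergWeight 𝒟 g A| * |selbergWeight 𝒟 g B| * r (A ∪ B) := by
  set w := selbergWeight 𝒟 g with hw
  have h1 : ((S.filter fun z => ∀ i ∈ P, ¬ E i z).card : ℝ) ≤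
      ∑ z ∈ S, (∑ A ∈ 𝒟, if ∀ i ∈ A, E i z then w A else 0) ^ 2 := by
    rw [Finset.card_filter, Nat.cast_sum]
    refine Finset.sum_le_sum fun z _ => ?_
    split_ifs with h
    · rw [Finset.sum_eq_single ∅]
      · simp [hw, selbergWeight_empty hg h0]
      · intro A hA hne
        obtain ⟨i, hi⟩ := Finset.nonempty_iff_ne_empty.2 hne
        exact if_neg fun h' => h i (hP A hA hi) (h' i hi)
      · exact fun h => absurd h0 h
    · simpa using sq_nonneg _
  have h2 : ∑ z ∈ S, (∑ A ∈ 𝒟, if ∀ i ∈ A, E i z then w A else 0) ^ 2 =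
      ∑ A ∈ 𝒟, ∑ B ∈ 𝒟, w A * w B * ((S.filter fun z => ∀ i ∈ A ∪ B, E i z).card : ℝ) := by
    simp_rw [sq, Finset.sum_mul_sum]
    rw [Finset.sum_comm]
    refine Finset.sum_congr rfl fun A _ => ?_
    rw [Finset.sum_comm]
    refine Finset.sum_congr rfl fun B _ => ?_
    rw [Finset.card_filter, Nat.cast_sum, Finset.mul_sum]
    refine Finset.sum_congr rfl fun z _ => ?_
    have : (∀ i ∈ A ∪ B, E i z) ↔ (∀ i ∈ A, E i z) ∧ ∀ i ∈ B, E i z := by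
      simp only [Finset.mem_union, or_imp, forall_and]
    simp only [this]
    exact ite_mul_ite_eq _ _ _ _
  have h3 : X / (∑ M ∈ 𝒟, ∏ i ∈ M, g i / (1 - g i)) =
      ∑ A ∈ 𝒟, ∑ B ∈ 𝒟, w A * w B * (X * ∏ i ∈ A ∪ B, g i) := by
    rw [div_eq_mul_inv, ← selbergWeight_quadratic_form hg h0 hdown, Finset.mul_sum]
    refine Finset.sum_congr rfl fun A _ => ?_
    rw [Finset.mul_sum]
    exact Finset.sum_congr rfl fun B _ => by ring
  rw [h2] at h1
  refine h1.trans ?_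
  rw [h3, ← Finset.sum_add_distrib]
  refine Finset.sum_le_sum fun A hA => ?_
  rw [← Finset.sum_add_distrib]
  refine Finset.sum_le_sum fun B hB => ?_
  have := hr (A ∪ B) (Finset.union_subset (hP A hA) (hP B hB))
  rw [← sub_le_iff_le_add', ← mul_sub, ← abs_mul]
  refine (le_abs_self _).trans ?_
  rw [abs_mul]
  exact mul_le_mul_of_nonneg_left this (abs_nonneg _)

end Selberg

theorem abs_card_Ioc_filter_modEq_sub_le (N m : ℕ) (hm : 0 < m) (c : ℤ) :
    |(((Finset.Ioc (0 : ℤ) N).filter fun z => z ≡ c [ZMOD m]).card : ℝ) - N / m| ≤ 1 := by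
  have hm' : (0 : ℝ) < m := by exact_mod_cast hm
  have h := Int.Ioc_filter_modEq_card 0 N (r := m) (by exact_mod_cast hm) c
  have h1 := Int.floor_le ((((N : ℤ) : ℚ) - c) / ((m : ℤ) : ℚ))
  have h2 := Int.lt_floor_add_one ((((N : ℤ) : ℚ) - c) / ((m : ℤ) : ℚ))
  have h3 := Int.floor_le ((((0 : ℤ) : ℚ) - c) / ((m : ℤ) : ℚ))
  have h4 := Int.lt_floor_add_one ((((0 : ℤ) : ℚ) - c) / ((m : ℤ) : ℚ))
  have hle : ⌊(((0 : ℤ) : ℚ) - c) / ((m : ℤ) : ℚ)⌋ ≤ ⌊(((N : ℤ) : ℚ) - c) / ((m : ℤ) : ℚ)⌋ := by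
    apply Int.floor_le_floor
    gcongr
    positivity
  rw [max_eq_left (by linarith)] at h
  set F := ⌊(((N : ℤ) : ℚ) - c) / ((m : ℤ) : ℚ)⌋
  set G := ⌊(((0 : ℤ) : ℚ) - c) / ((m : ℤ) : ℚ)⌋
  have hdiff : ((((N : ℤ) : ℚ) - c) / ((m : ℤ) : ℚ)) - ((((0 : ℤ) : ℚ) - c) / ((m : ℤ) : ℚ)) =
      (N : ℚ) / m := by push_cast; ring
  have h5 : |((F - G : ℤ) : ℚ) - (N : ℚ) / m| ≤ 1 := by
    rw [abs_le]; push_cast; constructor <;> linarith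
  have h6 : |((F - G : ℤ) : ℝ) - (N : ℝ) / m| ≤ 1 := by
    have := (Rat.cast_le (K := ℝ)).2 h5
    push_cast at this ⊢
    exact this
  rw [← h] at h6
  exact_mod_cast h6

theorem exists_forall_modEq_iff {m p : ℕ} (h : Nat.Coprime m p) (c u : ℤ) :
    ∃ c' : ℤ, ∀ z : ℤ, (z ≡ c [ZMOD m] ∧ z ≡ u [ZMOD p]) ↔ z ≡ c' [ZMOD (m * p : ℕ)] := by
  obtain ⟨s, t, hst⟩ := Nat.isCoprime_iff_coprime.2 h
  refine ⟨c * (t * p) + u * (s * m), fun z => ?_⟩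
  have h1 : c * (t * p) + u * (s * m) ≡ c [ZMOD m] :=
    (Int.modEq_iff_dvd.2 ⟨s * (c - u), by linear_combination (-c) * hst⟩)
  have h2 : c * (t * p) + u * (s * m) ≡ u [ZMOD p] :=
    (Int.modEq_iff_dvd.2 ⟨t * (u - c), by linear_combination (-u) * hst⟩)
  rw [Nat.cast_mul, ← Int.modEq_and_modEq_iff_modEq_mul (by simpa using h)]
  exact ⟨fun h => ⟨h.1.trans h1.symm, h.2.trans h2.symm⟩, fun h => ⟨h.1.trans h1, h.2.trans h2⟩⟩

theorem abs_card_two_classes_sub_le (N : ℕ) (u v : ℕ → ℤ) (A : Finset ℕ) :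
    (∀ p ∈ A, p.Prime) → (∀ p ∈ A, ¬ u p ≡ v p [ZMOD p]) →
    ∀ m : ℕ, 0 < m → (∀ p ∈ A, Nat.Coprime m p) → ∀ c : ℤ,
    |(((Finset.Ioc (0 : ℤ) N).filter fun z => z ≡ c [ZMOD m] ∧
      ∀ p ∈ A, z ≡ u p [ZMOD p] ∨ z ≡ v p [ZMOD p]).card : ℝ) -
      N / m * ∏ p ∈ A, (2 / p : ℝ)| ≤ 2 ^ A.card := by
  induction A using Finset.induction_on with
  | empty =>
    intro _ _ m hm _ c
    simpa using abs_card_Ioc_filter_modEq_sub_le N m hm c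
  | insert p A hpA ih =>
    intro hA huv m hm hcop c
    have hp := hA p (Finset.mem_insert_self _ _)
    have hA' : ∀ q ∈ A, q.Prime := fun q hq => hA q (Finset.mem_insert_of_mem hq)
    have hcop' : ∀ q ∈ A, Nat.Coprime (m * p) q := fun q hq =>
      Nat.Coprime.mul_left (hcop q (Finset.mem_insert_of_mem hq))
        ((Nat.coprime_primes hp (hA' q hq)).2 fun h => hpA (h ▸ hq))
    have hmp : 0 < m * p := Nat.mul_pos hm hp.pos
    obtain ⟨c₁, hc₁⟩ := exists_forall_modEq_iff (hcop p (Finset.mem_insert_self _ _)) c (u p)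
    obtain ⟨c₂, hc₂⟩ := exists_forall_modEq_iff (hcop p (Finset.mem_insert_self _ _)) c (v p)
    have ih' := ih hA' (fun q hq => huv q (Finset.mem_insert_of_mem hq)) (m * p) hmp hcop'
    have h1 := ih' c₁
    have h2 := ih' c₂
    have hcard : ((Finset.Ioc (0 : ℤ) N).filter fun z => z ≡ c [ZMOD m] ∧
        ∀ q ∈ insert p A, z ≡ u q [ZMOD q] ∨ z ≡ v q [ZMOD q]).card =
        ((Finset.Ioc (0 : ℤ) N).filter fun z => z ≡ c₁ [ZMOD (m * p : ℕ)] ∧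
          ∀ q ∈ A, z ≡ u q [ZMOD q] ∨ z ≡ v q [ZMOD q]).card +
        ((Finset.Ioc (0 : ℤ) N).filter fun z => z ≡ c₂ [ZMOD (m * p : ℕ)] ∧
          ∀ q ∈ A, z ≡ u q [ZMOD q] ∨ z ≡ v q [ZMOD q]).card := by
      rw [← Finset.card_union_of_disjoint]
      · congr 1
        ext z
        simp only [Finset.mem_filter, Finset.mem_union, Finset.forall_mem_insert, ← hc₁, ← hc₂]
        tauto
      · rw [Finset.disjoint_filter]
        rintro z - ⟨hz, -⟩ ⟨hz', -⟩
        exact huv p (Finset.mem_insert_self _ _) (((hc₁ z).2 hz).2.symm.trans ((hc₂ z).2 hz').2)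
    have hp0 : (p : ℝ) ≠ 0 := by exact_mod_cast hp.ne_zero
    have hm0 : (m : ℝ) ≠ 0 := by exact_mod_cast hm.ne'
    have hmain : (N : ℝ) / m * ∏ q ∈ insert p A, (2 / q : ℝ) =
        N / (m * p : ℕ) * ∏ q ∈ A, (2 / q : ℝ) + N / (m * p : ℕ) * ∏ q ∈ A, (2 / q : ℝ) := by
      rw [Finset.prod_insert hpA]
      push_cast
      field_simp
      ring
    rw [hcard, hmain, Finset.card_insert_of_notMem hpA, pow_succ, mul_two, Nat.cast_add,
      add_sub_add_comm]
    exact (abs_add_le _ _).trans (add_le_add h1 h2)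

theorem injOn_prod_of_primes {P : Finset ℕ} (hP : ∀ p ∈ P, p.Prime) :
    Set.InjOn (fun A : Finset ℕ => ∏ p ∈ A, p) {A | A ⊆ P} := by
  intro A hA B hB h
  have h1 : ∀ C ⊆ P, (∏ p ∈ C, p).primeFactors = C := fun C hC =>
    Nat.primeFactors_prod fun p hp => hP p (hC hp)
  rw [← h1 A hA, ← h1 B hB]
  exact congrArg Nat.primeFactors h

/-- The finite sets of primes from `P` whose product is at most `R`. -/
def primeSubsets (P : Finset ℕ) (R : ℕ) : Finset (Finset ℕ) :=
  P.powerset.filter fun A => ∏ p ∈ A, p ≤ R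

theorem sum_four_pow_card_le {P : Finset ℕ} (hP : ∀ p ∈ P, p.Prime) {δ : ℝ} (hδ : 0 ≤ δ)
    (h4 : ∀ p ∈ P, 4 ≤ (p : ℝ) ^ δ) (R : ℕ) :
    ∑ A ∈ primeSubsets P R, (4 : ℝ) ^ A.card ≤ R * (R : ℝ) ^ δ := by
  have hcard : (primeSubsets P R).card ≤ R := by
    have : (primeSubsets P R).card ≤ (Finset.Icc 1 R).card := by
      refine Finset.card_le_card_of_injOn (fun A => ∏ p ∈ A, p) (fun A hA => ?_)
        ((injOn_prod_of_primes hP).mono fun A hA => ?_)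
      · have hA' := Finset.mem_filter.1 hA
        exact Finset.mem_Icc.2 ⟨Finset.prod_pos fun p hp =>
          (hP p (Finset.mem_powerset.1 hA'.1 hp)).pos, hA'.2⟩
      · exact Finset.mem_powerset.1 (Finset.mem_filter.1 hA).1
    simpa using this
  refine (Finset.sum_le_card_nsmul _ _ ((R : ℝ) ^ δ) fun A hA => ?_).trans ?_
  · have hA' := Finset.mem_filter.1 hA
    have hAP := Finset.mem_powerset.1 hA'.1
    calc (4 : ℝ) ^ A.card = ∏ p ∈ A, (4 : ℝ) := by simp
      _ ≤ ∏ p ∈ A, (p : ℝ) ^ δ :=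
        Finset.prod_le_prod (fun _ _ => by norm_num) fun p hp => h4 p (hAP hp)
      _ = (∏ p ∈ A, (p : ℝ)) ^ δ := Real.finsetProd_rpow _ _ (fun _ _ => by positivity) _
      _ ≤ (R : ℝ) ^ δ := by
        refine Real.rpow_le_rpow (by positivity) ?_ hδ
        rw [← Nat.cast_prod]
        exact Nat.cast_le.2 hA'.2
  · rw [nsmul_eq_mul]
    have : ((primeSubsets P R).card : ℝ) ≤ R := by exact_mod_cast hcard
    gcongr

theorem card_two_classes_sieve_le {P : Finset ℕ} (hP : ∀ p ∈ P, p.Prime) (h5 : ∀ p ∈ P, 5 ≤ p)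
    {δ : ℝ} (hδ : 0 ≤ δ) (h4 : ∀ p ∈ P, 4 ≤ (p : ℝ) ^ δ) (N R : ℕ) (hR : 1 ≤ R)
    (u v : ℕ → ℤ) (huv : ∀ p ∈ P, ¬ u p ≡ v p [ZMOD p]) :
    (((Finset.Ioc (0 : ℤ) N).filter fun z =>
      ∀ p ∈ P, ¬ (z ≡ u p [ZMOD p] ∨ z ≡ v p [ZMOD p])).card : ℝ) ≤
      N / (∑ A ∈ primeSubsets P R, ∏ p ∈ A, (2 / p : ℝ) / (1 - 2 / p)) +
        (R * (R : ℝ) ^ δ) ^ 2 := by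
  have hmemP : ∀ M ∈ primeSubsets P R, M ⊆ P := fun M hM =>
    Finset.mem_powerset.1 (Finset.mem_filter.1 hM).1
  have hp5 : ∀ p ∈ P, (5 : ℝ) ≤ p := fun p hp => by exact_mod_cast h5 p hp
  have hg : ∀ M ∈ primeSubsets P R, ∀ p ∈ M, 0 < (2 / p : ℝ) ∧ (2 / p : ℝ) < 1 := by
    intro M hM p hp
    have := hp5 p (hmemP M hM hp)
    exact ⟨by positivity, by rw [div_lt_one (by linarith)]; linarith⟩
  have h0 : ∅ ∈ primeSubsets P R := by simp [primeSubsets, hR]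
  have hdown : ∀ M ∈ primeSubsets P R, ∀ A ⊆ M, A ∈ primeSubsets P R := by
    intro M hM A hA
    refine Finset.mem_filter.2 ⟨Finset.mem_powerset.2 (hA.trans (hmemP M hM)), ?_⟩
    refine (Nat.le_of_dvd ?_ (Finset.prod_dvd_prod_of_subset _ _ _ hA)).trans
      (Finset.mem_filter.1 hM).2
    exact Finset.prod_pos fun p hp => (hP p (hmemP M hM hp)).pos
  have hr : ∀ A ⊆ P, |((((Finset.Ioc (0 : ℤ) N).filter fun z =>
      ∀ p ∈ A, z ≡ u p [ZMOD p] ∨ z ≡ v p [ZMOD p]).card : ℝ)) -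
      N * ∏ p ∈ A, (2 / p : ℝ)| ≤ 2 ^ A.card := by
    intro A hA
    simpa [Int.modEq_one] using abs_card_two_classes_sub_le N u v A (fun p hp => hP p (hA hp))
      (fun p hp => huv p (hA hp)) 1 one_pos (fun p _ => Nat.coprime_one_left p) 0
  refine (selberg_sieve (Finset.Ioc (0 : ℤ) N) P
    (fun p z => z ≡ u p [ZMOD p] ∨ z ≡ v p [ZMOD p]) N (fun A => 2 ^ A.card)
    hmemP hg h0 hdown hr).trans ?_
  gcongr
  have hw : ∀ A ∈ primeSubsets P R,
      |selbergWeight (primeSubsets P R) (fun p : ℕ => (2 / p : ℝ)) A| ≤ 2 ^ A.card := by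
    intro A hA
    refine (abs_selbergWeight_le hg h0 hdown hA).trans ?_
    rw [← Finset.prod_const]
    have hpos : ∀ p ∈ A, (0 : ℝ) ≤ 1 / (1 - 2 / p) := fun p hp =>
      one_div_nonneg.2 (sub_pos.2 (hg A hA p hp).2).le
    refine Finset.prod_le_prod hpos fun p hp => ?_
    have := hp5 p (hmemP A hA hp)
    have h2 : (2 / p : ℝ) ≤ 1 / 2 := by
      rw [div_le_div_iff₀ (by linarith) (by norm_num)]; linarith
    rw [div_le_iff₀ (by linarith)]
    linarith
  calc _ ≤ ∑ A ∈ primeSubsets P R, ∑ B ∈ primeSubsets P R, (4 : ℝ) ^ A.card * 4 ^ B.card := by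
        refine Finset.sum_le_sum fun A hA => Finset.sum_le_sum fun B hB => ?_
        have h2 : (2 : ℝ) ^ (A ∪ B).card ≤ 2 ^ A.card * 2 ^ B.card := by
          rw [← pow_add]
          exact pow_le_pow_right₀ (by norm_num) (Finset.card_union_le A B)
        calc _ ≤ (2 : ℝ) ^ A.card * 2 ^ B.card * (2 ^ A.card * 2 ^ B.card) := by
              gcongr
              · exact hw A hA
              · exact hw B hB
          _ = _ := by
              rw [show (4 : ℝ) = 2 * 2 by norm_num, mul_pow, mul_pow]; ring
    _ = (∑ A ∈ primeSubsets P R, (4 : ℝ) ^ A.card) ^ 2 := by rw [sq, Finset.sum_mul_sum]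
    _ ≤ _ := by
        gcongr
        exact sum_four_pow_card_le hP hδ h4 R

/-- The sum of `τ(n) / n` over `n ≤ N` all of whose prime factors lie in `Q`. -/
noncomputable def factoredDivisorSum (Q : Finset ℕ) (N : ℕ) : ℝ :=
  ∑ n ∈ (Finset.Icc 1 N).filter fun n => n.primeFactors ⊆ Q, (n.divisors.card : ℝ) / n

theorem factoredDivisorSum_nonneg (Q : Finset ℕ) (N : ℕ) : 0 ≤ factoredDivisorSum Q N :=
  Finset.sum_nonneg fun _ _ => by positivity

theorem factoredDivisorSum_mono (Q : Finset ℕ) {M N : ℕ} (h : M ≤ N) :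
    factoredDivisorSum Q M ≤ factoredDivisorSum Q N :=
  Finset.sum_le_sum_of_subset_of_nonneg
    (Finset.filter_subset_filter _ (Finset.Icc_subset_Icc_right h)) fun _ _ _ => by positivity

theorem factoredDivisorSum_insert_le {Q : Finset ℕ} {p : ℕ} (hp : p.Prime) (hpQ : p ∉ Q) (N : ℕ) :
    factoredDivisorSum (insert p Q) N ≤
      ∑ k ∈ Finset.range (N + 1), ((k + 1 : ℝ) * (1 / p) ^ k) * factoredDivisorSum Q (N / p ^ k) := by
  set S := (Finset.Icc 1 N).filter fun n => n.primeFactors ⊆ insert p Q with hS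
  have hmaps : ∀ n ∈ S, n.factorization p ∈ Finset.range (N + 1) := by
    intro n hn
    have hn' := Finset.mem_Icc.1 (Finset.mem_filter.1 hn).1
    exact Finset.mem_range.2 (Nat.lt_succ_of_le
      ((Nat.factorization_lt p (by omega)).le.trans hn'.2))
  rw [factoredDivisorSum, ← Finset.sum_fiberwise_of_maps_to hmaps]
  refine Finset.sum_le_sum fun k _ => ?_
  rw [factoredDivisorSum, Finset.mul_sum]
  have hcop : ∀ n ∈ S.filter (fun n => n.factorization p = k), p ^ k * (n / p ^ k) = n ∧
      Nat.Coprime (p ^ k) (n / p ^ k) := by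
    intro n hn
    have hn1 := Finset.mem_filter.1 hn
    have hn0 : n ≠ 0 := by
      have := Finset.mem_Icc.1 (Finset.mem_filter.1 hn1.1).1
      omega
    rw [← hn1.2]
    exact ⟨Nat.ordProj_mul_ordCompl_eq_self n p, (Nat.coprime_ordCompl hp hn0).pow_left _⟩
  have hinj : Set.InjOn (fun n => n / p ^ k) (S.filter (fun n => n.factorization p = k) : Finset ℕ) := by
    intro n hn m hm h
    rw [← (hcop n hn).1, ← (hcop m hm).1]
    exact congrArg (p ^ k * ·) h
  have hterm : ∀ n ∈ S.filter (fun n => n.factorization p = k), (n.divisors.card : ℝ) / n =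
      ((k + 1 : ℝ) * (1 / p) ^ k) * (((n / p ^ k).divisors.card : ℝ) / (n / p ^ k : ℕ)) := by
    intro n hn
    obtain ⟨h1, h2⟩ := hcop n hn
    have hd : n.divisors.card = (k + 1) * (n / p ^ k).divisors.card := by
      conv_lhs => rw [← h1]
      rw [h2.card_divisors_mul, Nat.divisors_prime_pow hp, Finset.card_map, Finset.card_range]
    have hn' : (n : ℝ) = (p : ℝ) ^ k * (n / p ^ k : ℕ) := by
      conv_lhs => rw [← h1]
      push_cast
      rfl
    rw [hd, hn']
    push_cast
    rw [mul_div_mul_comm, one_div, inv_pow, ← div_eq_mul_inv]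
  rw [Finset.sum_congr rfl hterm]
  rw [← Finset.sum_image (f := fun m : ℕ => ((k + 1 : ℝ) * (1 / p) ^ k) *
    ((m.divisors.card : ℝ) / m)) hinj]
  refine Finset.sum_le_sum_of_subset_of_nonneg ?_ fun _ _ _ => by positivity
  intro m hm
  obtain ⟨n, hn, rfl⟩ := Finset.mem_image.1 hm
  obtain ⟨h1, h2⟩ := hcop n hn
  have hn1 := Finset.mem_filter.1 hn
  have hn2 := Finset.mem_filter.1 hn1.1
  have hn3 := Finset.mem_Icc.1 hn2.1
  have hpk : 0 < p ^ k := pow_pos hp.pos k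
  refine Finset.mem_filter.2 ⟨Finset.mem_Icc.2 ⟨?_, Nat.div_le_div_right hn3.2⟩, ?_⟩
  · rw [Nat.one_le_iff_ne_zero]
    intro h
    rw [h] at h1
    omega
  · intro q hq
    have hqn : q ∈ n.primeFactors := by
      refine Nat.primeFactors_mono ⟨p ^ k, ?_⟩ (by omega) hq
      rw [mul_comm, h1]
    rcases Finset.mem_insert.1 (hn2.2 hqn) with rfl | h
    · have hdvd := Nat.dvd_of_mem_primeFactors hq
      rw [← hn1.2] at hdvd
      exact absurd hdvd (Nat.not_dvd_ordCompl hp (by omega))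
    · exact h

theorem sum_range_succ_mul_pow_le {r : ℝ} (h0 : 0 ≤ r) (h1 : r < 1) (n : ℕ) :
    ∑ k ∈ Finset.range n, ((k + 1 : ℝ) * r ^ k) ≤ ((1 - r)⁻¹) ^ 2 := by
  have h := hasSum_choose_mul_geometric_of_norm_lt_one 1 (r := r)
    (by rw [Real.norm_eq_abs, abs_of_nonneg h0]; exact h1)
  simp only [Nat.choose_one_right] at h
  have := sum_le_hasSum (Finset.range n) (fun k _ => by positivity) h
  simpa [one_div] using this

theorem factoredDivisorSum_insert_le_mul {Q : Finset ℕ} {p : ℕ} (hp : p.Prime) (hpQ : p ∉ Q)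
    (N : ℕ) :
    factoredDivisorSum (insert p Q) N ≤ ((1 - 1 / p : ℝ)⁻¹) ^ 2 * factoredDivisorSum Q N := by
  have hp2 : (2 : ℝ) ≤ p := by exact_mod_cast hp.two_le
  have hr : (1 / p : ℝ) < 1 := by rw [div_lt_one (by linarith)]; linarith
  refine (factoredDivisorSum_insert_le hp hpQ N).trans ?_
  refine le_trans ?_ (mul_le_mul_of_nonneg_right
    (sum_range_succ_mul_pow_le (by positivity) hr (N + 1)) (factoredDivisorSum_nonneg Q N))
  rw [Finset.sum_mul]
  gcongr
  exact factoredDivisorSum_mono Q (Nat.div_le_self _ _)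

theorem factoredDivisorSum_insert_le_add {Q : Finset ℕ} {p : ℕ} (hp : p.Prime) (h3 : 3 ≤ p)
    (hpQ : p ∉ Q) (N : ℕ) :
    factoredDivisorSum (insert p Q) N ≤ factoredDivisorSum Q N +
      (2 / p : ℝ) / (1 - 2 / p) * factoredDivisorSum Q (N / p) := by
  have hp3 : (3 : ℝ) ≤ p := by exact_mod_cast h3
  have hr : (1 / p : ℝ) < 1 := by rw [div_lt_one (by linarith)]; linarith
  refine (factoredDivisorSum_insert_le hp hpQ N).trans ?_
  rw [Finset.sum_range_succ']
  simp only [pow_zero, Nat.div_one, Nat.cast_zero, zero_add, mul_one, one_mul]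
  rw [add_comm]
  gcongr
  have h1 : ∑ k ∈ Finset.range N, (((k + 1 : ℕ) + 1 : ℝ) * (1 / p) ^ (k + 1)) ≤
      (2 / p : ℝ) / (1 - 2 / p) := by
    have h := sum_range_succ_mul_pow_le (r := 1 / p) (by positivity) hr (N + 1)
    rw [Finset.sum_range_succ'] at h
    simp only [pow_zero, Nat.cast_zero, zero_add, mul_one] at h
    have h2 : ((1 - 1 / p : ℝ)⁻¹) ^ 2 - 1 ≤ (2 / p : ℝ) / (1 - 2 / p) := by
      have e1 : ((1 - 1 / p : ℝ)⁻¹) ^ 2 - 1 = (2 * p - 1) / (p - 1) ^ 2 := by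
        have : (p : ℝ) - 1 ≠ 0 := by linarith
        have : (p : ℝ) ≠ 0 := by linarith
        field_simp
        ring
      have e2 : (2 / p : ℝ) / (1 - 2 / p) = 2 / (p - 2) := by
        have : (p : ℝ) - 2 ≠ 0 := by linarith
        have : (p : ℝ) ≠ 0 := by linarith
        field_simp
      rw [e1, e2, div_le_div_iff₀ (by nlinarith) (by linarith)]
      nlinarith
    linarith
  refine le_trans ?_ (mul_le_mul_of_nonneg_right h1 (factoredDivisorSum_nonneg Q _))
  rw [Finset.sum_mul]
  gcongr with k _
  refine factoredDivisorSum_mono Q (Nat.div_le_div_left ?_ hp.pos)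
  exact Nat.le_self_pow (by omega) p

theorem factoredDivisorSum_le_prod {E : Finset ℕ} (hE : ∀ p ∈ E, p.Prime) {N : ℕ} (hN : 1 ≤ N) :
    factoredDivisorSum E N ≤ (∏ p ∈ E, (1 - 1 / p : ℝ)⁻¹) ^ 2 := by
  induction E using Finset.induction_on with
  | empty =>
    have : (Finset.Icc 1 N).filter (fun n => n.primeFactors ⊆ ∅) = {1} := by
      ext n
      simp only [Finset.mem_filter, Finset.mem_Icc, Finset.subset_empty, Nat.primeFactors_eq_empty,
        Finset.mem_singleton]
      omega
    rw [factoredDivisorSum, this]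
    simp
  | insert p E hpE ih =>
    refine (factoredDivisorSum_insert_le_mul (hE p (Finset.mem_insert_self _ _)) hpE N).trans ?_
    rw [Finset.prod_insert hpE, mul_pow]
    gcongr
    exact ih fun q hq => hE q (Finset.mem_insert_of_mem hq)

theorem sum_primeSubsets_insert {P : Finset ℕ} {p : ℕ} (hp : 0 < p) (hpP : p ∉ P) (h : ℕ → ℝ)
    (N : ℕ) :
    ∑ A ∈ primeSubsets (insert p P) N, ∏ q ∈ A, h q =
      ∑ A ∈ primeSubsets P N, ∏ q ∈ A, h q +
        h p * ∑ A ∈ primeSubsets P (N / p), ∏ q ∈ A, h q := by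
  simp only [primeSubsets, Finset.sum_filter]
  rw [Finset.sum_powerset_insert hpP, Finset.mul_sum]
  congr 1
  refine Finset.sum_congr rfl fun A hA => ?_
  have hpA : p ∉ A := fun h => hpP (Finset.mem_powerset.1 hA h)
  rw [Finset.prod_insert hpA, Finset.prod_insert hpA, mul_ite, mul_zero]
  exact if_congr (by rw [mul_comm p, Nat.le_div_iff_mul_le hp]) rfl rfl

theorem factoredDivisorSum_union_le {E P : Finset ℕ} (hE : ∀ p ∈ E, p.Prime)
    (hP : ∀ p ∈ P, p.Prime ∧ 3 ≤ p) (hEP : Disjoint P E) (N : ℕ) :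
    factoredDivisorSum (P ∪ E) N ≤ (∏ p ∈ E, (1 - 1 / p : ℝ)⁻¹) ^ 2 *
      ∑ A ∈ primeSubsets P N, ∏ p ∈ A, (2 / p : ℝ) / (1 - 2 / p) := by
  induction P using Finset.induction_on generalizing N with
  | empty =>
    rcases Nat.eq_zero_or_pos N with rfl | hN
    · have : primeSubsets ∅ 0 = ∅ := by
        simp [primeSubsets, Finset.filter_singleton]
      rw [this]
      simp [factoredDivisorSum]
    · have : primeSubsets ∅ N = {∅} := by
        ext A
        simp only [primeSubsets, Finset.powerset_empty, Finset.mem_filter, Finset.mem_singleton]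
        exact ⟨fun h => h.1, fun h => ⟨h, by subst h; exact hN⟩⟩
      rw [this]
      simpa using factoredDivisorSum_le_prod hE hN
  | insert p P hpP ih =>
    have hp := hP p (Finset.mem_insert_self _ _)
    rw [Finset.disjoint_insert_left] at hEP
    have ih' := ih (fun q hq => hP q (Finset.mem_insert_of_mem hq)) hEP.2
    have hh : (0 : ℝ) ≤ (2 / p : ℝ) / (1 - 2 / p) := by
      have hp3 : (3 : ℝ) ≤ p := by exact_mod_cast hp.2
      refine div_nonneg (by positivity) (sub_nonneg.2 ?_)
      rw [div_le_one (by linarith)]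
      linarith
    rw [Finset.insert_union, sum_primeSubsets_insert hp.1.pos hpP, mul_add]
    refine (factoredDivisorSum_insert_le_add hp.1 hp.2 (by simp [hpP, hEP.1]) N).trans ?_
    refine add_le_add (ih' N) ?_
    rw [mul_left_comm]
    exact mul_le_mul_of_nonneg_left (ih' _) hh

theorem half_log_sq_le_sum {N : ℕ} (hN : 1 ≤ N) :
    Real.log N ^ 2 / 2 ≤ ∑ a ∈ Finset.Icc 1 N, (1 / a : ℝ) * (Real.log N - Real.log a) := by
  induction N, hN using Nat.le_induction with
  | base => simp
  | succ N hN ih =>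
    rw [Finset.sum_Icc_succ_top (by omega), sub_self, mul_zero, add_zero]
    have h1 : ∑ a ∈ Finset.Icc 1 N, (1 / a : ℝ) * (Real.log (N + 1 : ℕ) - Real.log a) =
        ∑ a ∈ Finset.Icc 1 N, (1 / a : ℝ) * (Real.log N - Real.log a) +
          (∑ a ∈ Finset.Icc 1 N, (1 / a : ℝ)) * (Real.log (N + 1 : ℕ) - Real.log N) := by
      rw [Finset.sum_mul, ← Finset.sum_add_distrib]
      exact Finset.sum_congr rfl fun a _ => by ring
    have h2 : Real.log (N + 1 : ℕ) ≤ ∑ a ∈ Finset.Icc 1 N, (1 / a : ℝ) := by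
      have := log_add_one_le_harmonic N
      rw [harmonic_eq_sum_Icc] at this
      push_cast at this ⊢
      simpa [one_div] using this
    have h3 : Real.log N ≤ Real.log (N + 1 : ℕ) :=
      Real.log_le_log (by exact_mod_cast hN) (by push_cast; linarith)
    rw [h1]
    nlinarith [mul_le_mul_of_nonneg_right h2 (sub_nonneg.2 h3)]

theorem half_log_sq_le_factoredDivisorSum {Q : Finset ℕ} {N : ℕ} (hN : 1 ≤ N)
    (hQ : ∀ p, p.Prime → p ≤ N → p ∈ Q) :
    Real.log N ^ 2 / 2 ≤ factoredDivisorSum Q N := by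
  have hset : (Finset.Icc 1 N).filter (fun n => n.primeFactors ⊆ Q) = Finset.Icc 1 N := by
    refine Finset.filter_true_of_mem fun n hn p hp => ?_
    have hn' := Finset.mem_Icc.1 hn
    exact hQ p (Nat.prime_of_mem_primeFactors hp)
      ((Nat.le_of_mem_primeFactors hp).trans hn'.2)
  rw [factoredDivisorSum, hset]
  refine (half_log_sq_le_sum hN).trans ?_
  have h1 : ∀ a ∈ Finset.Icc 1 N, (1 / a : ℝ) * (Real.log N - Real.log a) ≤
      ∑ b ∈ Finset.Icc 1 (N / a), (1 / (a * b : ℕ) : ℝ) := by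
    intro a ha
    have ha' := Finset.mem_Icc.1 ha
    have ha0 : (0 : ℝ) < a := by exact_mod_cast ha'.1
    have h2 : Real.log N - Real.log a ≤ Real.log (N / a + 1 : ℕ) := by
      rw [← Real.log_div (by positivity) ha0.ne']
      refine Real.log_le_log (by positivity) ?_
      rw [div_le_iff₀ ha0]
      have := Nat.lt_div_mul_add (a := N) (b := a) ha'.1
      have h3 : N ≤ (N / a + 1) * a := by rw [add_mul]; omega
      exact_mod_cast h3
    have h4 := log_add_one_le_harmonic (N / a)
    rw [harmonic_eq_sum_Icc] at h4
    push_cast at h4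
    have h5 : ∑ b ∈ Finset.Icc 1 (N / a), (1 / (a * b : ℕ) : ℝ) =
        (1 / a) * ∑ b ∈ Finset.Icc 1 (N / a), (b : ℝ)⁻¹ := by
      rw [Finset.mul_sum]
      refine Finset.sum_congr rfl fun b _ => ?_
      push_cast
      rw [one_div, mul_inv, one_div]
    rw [h5]
    push_cast at h2
    exact mul_le_mul_of_nonneg_left (h2.trans h4) (by positivity)
  refine (Finset.sum_le_sum h1).trans (le_of_eq ?_)
  have h6 : ∀ n ∈ Finset.Icc 1 N, (n.divisors.card : ℝ) / n =
      ∑ a ∈ Finset.Icc 1 N, if a ∣ n then (1 / n : ℝ) else 0 := by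
    intro n hn
    have hn' := Finset.mem_Icc.1 hn
    rw [← Finset.sum_filter, Finset.sum_const, nsmul_eq_mul, mul_one_div]
    congr 2
    refine congrArg Finset.card ?_
    ext a
    simp only [Nat.mem_divisors, Finset.mem_filter, Finset.mem_Icc]
    constructor
    · intro h
      exact ⟨⟨Nat.pos_of_dvd_of_pos h.1 (by omega),
        (Nat.le_of_dvd (by omega) h.1).trans hn'.2⟩, h.1⟩
    · intro h
      exact ⟨h.2, by omega⟩
  rw [Finset.sum_congr rfl h6, Finset.sum_comm]
  refine Finset.sum_congr rfl fun a ha => ?_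
  have ha' := Finset.mem_Icc.1 ha
  rw [← Finset.sum_filter]
  refine Finset.sum_nbij' (fun b => a * b) (fun n => n / a) ?_ ?_ ?_ ?_ ?_
  · intro b hb
    have hb' := Finset.mem_Icc.1 hb
    refine Finset.mem_filter.2 ⟨Finset.mem_Icc.2 ⟨Nat.mul_pos ha'.1 hb'.1, ?_⟩, dvd_mul_right _ _⟩
    rw [mul_comm]
    exact (Nat.le_div_iff_mul_le ha'.1).1 hb'.2
  · intro n hn
    obtain ⟨hn1, hn2⟩ := Finset.mem_filter.1 hn
    have hn' := Finset.mem_Icc.1 hn1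
    exact Finset.mem_Icc.2 ⟨Nat.div_pos (Nat.le_of_dvd hn'.1 hn2) ha'.1,
      Nat.div_le_div_right hn'.2⟩
  · intro b _
    exact Nat.mul_div_cancel_left b ha'.1
  · intro n hn
    exact Nat.mul_div_cancel' (Finset.mem_filter.1 hn).2
  · intro b _
    rfl

theorem half_log_sq_le_selberg_sum {E P : Finset ℕ} (hE : ∀ p ∈ E, p.Prime)
    (hP : ∀ p ∈ P, p.Prime ∧ 3 ≤ p) (hEP : Disjoint P E) {R : ℕ} (hR : 1 ≤ R)
    (hall : ∀ p, p.Prime → p ≤ R → p ∈ P ∪ E) :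
    Real.log R ^ 2 / 2 ≤ (∏ p ∈ E, (1 - 1 / p : ℝ)⁻¹) ^ 2 *
      ∑ A ∈ primeSubsets P R, ∏ p ∈ A, (2 / p : ℝ) / (1 - 2 / p) :=
  (half_log_sq_le_factoredDivisorSum hR hall).trans (factoredDivisorSum_union_le hE hP hEP R)

theorem log_factorial_eq_sum_primes (N : ℕ) :
    Real.log (N.factorial : ℝ) =
      ∑ p ∈ (Finset.range (N + 1)).filter Nat.Prime,
        (N.factorial.factorization p : ℝ) * Real.log p := by
  rw [Real.log_nat_eq_sum_factorization]
  refine Finsupp.sum_of_support_subset _ ?_ _ (by simp)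
  intro p hp
  rw [Nat.support_factorization, Nat.mem_primeFactors] at hp
  simp only [Finset.mem_filter, Finset.mem_range]
  exact ⟨Nat.lt_succ_of_le ((hp.1.dvd_factorial).1 hp.2.1), hp.1⟩

theorem sum_log_div_primes_le {N : ℕ} (hN : 1 ≤ N) :
    ∑ p ∈ (Finset.range (N + 1)).filter Nat.Prime, Real.log p / p
      ≤ Real.log N + Real.log 4 := by
  have hN0 : (0 : ℝ) < N := by exact_mod_cast hN
  have hfac : Real.log (N.factorial : ℝ) ≤ N * Real.log N := by
    rw [← Real.log_pow]
    refine Real.log_le_log (by exact_mod_cast N.factorial_pos) ?_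
    exact_mod_cast Nat.factorial_le_pow N
  have htheta : ∑ p ∈ (Finset.range (N + 1)).filter Nat.Prime, Real.log p ≤ Real.log 4 * N := by
    have h := Chebyshev.theta_le_log4_mul_x hN0.le
    rw [Chebyshev.theta_eq_sum_Icc, Nat.floor_natCast] at h
    convert h using 3
    ext i
    simp
  have hmain : N * ∑ p ∈ (Finset.range (N + 1)).filter Nat.Prime, Real.log p / p
      ≤ Real.log (N.factorial : ℝ) +
        ∑ p ∈ (Finset.range (N + 1)).filter Nat.Prime, Real.log p := by
    rw [log_factorial_eq_sum_primes, ← Finset.sum_add_distrib, Finset.mul_sum]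
    refine Finset.sum_le_sum fun p hp => ?_
    simp only [Finset.mem_filter, Finset.mem_range] at hp
    have hpN : p ≤ N := by omega
    have hv : N / p ≤ N.factorial.factorization p := by
      rw [Nat.factorization_factorial hp.2 (Nat.lt_succ_self _)]
      have h1 : 1 ∈ Finset.Ico 1 (Nat.log p N).succ := by
        simp [Nat.log_pos hp.2.one_lt hpN]
      simpa using Finset.single_le_sum (f := fun i => N / p ^ i) (fun i _ => Nat.zero_le _) h1
    have hfl : (N : ℝ) / p - 1 ≤ N.factorial.factorization p := by
      have h1 := Nat.lt_floor_add_one ((N : ℝ) / p)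
      rw [Nat.floor_div_eq_div] at h1
      have h2 : ((N / p : ℕ) : ℝ) ≤ N.factorial.factorization p := by exact_mod_cast hv
      linarith
    have hlog : 0 ≤ Real.log p := Real.log_natCast_nonneg p
    calc (N : ℝ) * (Real.log p / p) = (N / p) * Real.log p := by ring
      _ ≤ (N.factorial.factorization p + 1) * Real.log p := by gcongr; linarith
      _ = _ := by ring
  have : N * ∑ p ∈ (Finset.range (N + 1)).filter Nat.Prime, Real.log p / p
      ≤ N * (Real.log N + Real.log 4) := by linarith
  exact le_of_mul_le_mul_left this hN0

theorem exists_log_le_sum_log_div_primes :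
    ∃ C : ℝ, ∀ N : ℕ, 1 ≤ N →
      Real.log N - C ≤ ∑ p ∈ (Finset.range (N + 1)).filter Nat.Prime, Real.log p / p := by
  have hsum : Summable fun n : ℕ => 4 * (n : ℝ) ^ (-(3 / 2) : ℝ) :=
    (Real.summable_nat_rpow.2 (by norm_num)).mul_left 4
  refine ⟨1 + ∑' n : ℕ, 4 * (n : ℝ) ^ (-(3 / 2) : ℝ), fun N hN => ?_⟩
  have hN0 : (0 : ℝ) < N := by exact_mod_cast hN
  have hfac : N * Real.log N - N ≤ Real.log (N.factorial : ℝ) := by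
    have h := Real.pow_div_factorial_le_exp (N : ℝ) hN0.le N
    have hf : (0 : ℝ) < N.factorial := by exact_mod_cast N.factorial_pos
    have h2 := Real.log_le_log (by positivity) h
    rw [Real.log_exp, Real.log_div (by positivity) (by positivity), Real.log_pow] at h2
    linarith
  have htail : ∑ p ∈ (Finset.range (N + 1)).filter Nat.Prime, Real.log p / (p * (p - 1))
      ≤ ∑' n : ℕ, 4 * (n : ℝ) ^ (-(3 / 2) : ℝ) := by
    refine le_trans (Finset.sum_le_sum fun p hp => ?_)
      (hsum.sum_le_tsum ((Finset.range (N + 1)).filter Nat.Prime) fun i _ => by positivity)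
    simp only [Finset.mem_filter, Finset.mem_range] at hp
    have hp2 : (2 : ℝ) ≤ p := by exact_mod_cast hp.2.two_le
    have hl := Real.log_le_rpow_div (by positivity : (0 : ℝ) ≤ p) (by norm_num : (0 : ℝ) < 1 / 2)
    have hmul : (p : ℝ) ^ (1 / 2 : ℝ) = (p : ℝ) ^ (-(3 / 2) : ℝ) * p ^ 2 := by
      rw [← Real.rpow_natCast, ← Real.rpow_add (by positivity)]
      norm_num
    rw [div_le_iff₀ (by nlinarith)]
    have hr : 0 ≤ (p : ℝ) ^ (-(3 / 2) : ℝ) := by positivity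
    calc Real.log p ≤ (p : ℝ) ^ (1 / 2 : ℝ) / (1 / 2) := hl
      _ = (p : ℝ) ^ (-(3 / 2) : ℝ) * (2 * p ^ 2) := by rw [hmul]; ring
      _ ≤ (p : ℝ) ^ (-(3 / 2) : ℝ) * (4 * (p * (p - 1))) :=
        mul_le_mul_of_nonneg_left (by nlinarith) hr
      _ = _ := by ring
  have hmain : Real.log (N.factorial : ℝ) ≤
      N * (∑ p ∈ (Finset.range (N + 1)).filter Nat.Prime, Real.log p / p +
        ∑ p ∈ (Finset.range (N + 1)).filter Nat.Prime, Real.log p / (p * (p - 1))) := by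
    rw [log_factorial_eq_sum_primes, ← Finset.sum_add_distrib, Finset.mul_sum]
    refine Finset.sum_le_sum fun p hp => ?_
    simp only [Finset.mem_filter, Finset.mem_range] at hp
    have hp2 : (2 : ℝ) ≤ p := by exact_mod_cast hp.2.two_le
    have hlog : 0 ≤ Real.log p := Real.log_natCast_nonneg p
    have hv : (N.factorial.factorization p : ℝ) ≤ N / (p - 1) := by
      calc (N.factorial.factorization p : ℝ) ≤ ((N / (p - 1) : ℕ) : ℝ) := by
            exact_mod_cast Nat.factorization_factorial_le_div_pred hp.2 N
        _ ≤ (N : ℝ) / ((p - 1 : ℕ) : ℝ) := Nat.cast_div_le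
        _ = N / (p - 1) := by rw [Nat.cast_pred hp.2.pos]
    calc (N.factorial.factorization p : ℝ) * Real.log p ≤ N / (p - 1) * Real.log p := by gcongr
      _ = _ := by
        have : (p : ℝ) - 1 ≠ 0 := by linarith
        field_simp
        ring
  have hle : N * (Real.log N - 1) ≤
      N * (∑ p ∈ (Finset.range (N + 1)).filter Nat.Prime, Real.log p / p +
        ∑ p ∈ (Finset.range (N + 1)).filter Nat.Prime, Real.log p / (p * (p - 1))) := by linarith
  have := le_of_mul_le_mul_left hle hN0
  linarith

noncomputable def primeHarmonic (N : ℕ) : ℝ :=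
  ∑ n ∈ Finset.range (N + 1), if n.Prime then (1 / n : ℝ) else 0

theorem primeHarmonic_add_one (N : ℕ) :
    primeHarmonic (N + 1) =
      ∑ i ∈ Finset.range N, if (i + 2).Prime then (1 / (i + 2 : ℕ) : ℝ) else 0 := by
  rw [primeHarmonic, Finset.sum_range_succ', Finset.sum_range_succ']
  simp [Nat.not_prime_zero, Nat.not_prime_one, add_assoc, one_add_one_eq_two]

theorem exists_tendsto_sum_primes_sub_inv_mul_log :
    ∃ c : ℝ, Filter.Tendsto (fun N : ℕ => primeHarmonic (N + 1) -
      ∑ i ∈ Finset.range N, 1 / ((i + 2 : ℝ) * Real.log (i + 2))) Filter.atTop (nhds c) := by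
  obtain ⟨C, hC⟩ := exists_log_le_sum_log_div_primes
  have hanti : Antitone fun i : ℕ => 1 / Real.log (i + 2 : ℝ) := by
    intro i j hij
    have hi : 0 < Real.log (i + 2 : ℝ) := Real.log_pos (by linarith [Nat.cast_nonneg (α := ℝ) i])
    have hij' : (i : ℝ) ≤ j := by exact_mod_cast hij
    exact one_div_le_one_div_of_le hi (Real.log_le_log (by positivity) (by linarith))
  have hzero : Filter.Tendsto (fun i : ℕ => 1 / Real.log (i + 2 : ℝ)) Filter.atTop (nhds 0) := by
    simp only [one_div]
    exact (Real.tendsto_log_atTop.comp (Filter.tendsto_atTop_add_const_right _ _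
      tendsto_natCast_atTop_atTop)).inv_tendsto_atTop
  have hbdd : ∀ N : ℕ, ‖∑ i ∈ Finset.range N,
      ((if (i + 2).Prime then Real.log (i + 2 : ℕ) / (i + 2 : ℕ) else 0)
        - 1 / (i + 2 : ℝ))‖ ≤ |C| + Real.log 4 + 1 := by
    intro N
    have hS : ∑ i ∈ Finset.range N,
        (if (i + 2).Prime then Real.log (i + 2 : ℕ) / (i + 2 : ℕ) else 0) =
        ∑ p ∈ (Finset.range (N + 1 + 1)).filter Nat.Prime, Real.log p / p := by
      rw [Finset.sum_filter, Finset.sum_range_succ', Finset.sum_range_succ']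
      simp [Nat.not_prime_zero, Nat.not_prime_one, add_assoc, one_add_one_eq_two]
    have hH : ∑ i ∈ Finset.range N, 1 / (i + 2 : ℝ) = (harmonic (N + 1) : ℝ) - 1 := by
      rw [harmonic, Finset.sum_range_succ']
      push_cast
      simp only [one_div]
      ring_nf
    have h1 := sum_log_div_primes_le (N := N + 1) (by omega)
    have h2 := hC (N + 1) (by omega)
    have h3 := log_add_one_le_harmonic (N + 1)
    have h4 := harmonic_le_one_add_log (N + 1)
    have h5 : Real.log (N + 1 : ℕ) ≤ Real.log (N + 1 + 1 : ℕ) :=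
      Real.log_le_log (by positivity) (by push_cast; linarith)
    rw [Finset.sum_sub_distrib, hS, hH, Real.norm_eq_abs, abs_le]
    have := le_abs_self C
    have := Real.log_nonneg (by norm_num : (1 : ℝ) ≤ 4)
    constructor <;> linarith [abs_nonneg C]
  obtain ⟨c, hc⟩ := cauchySeq_tendsto_of_complete
    (hanti.cauchySeq_series_mul_of_tendsto_zero_of_bounded hzero hbdd)
  refine ⟨c, hc.congr fun N => ?_⟩
  rw [primeHarmonic_add_one, ← Finset.sum_sub_distrib]
  refine Finset.sum_congr rfl fun i _ => ?_
  have hi : 0 < Real.log (i + 2 : ℝ) := Real.log_pos (by linarith [Nat.cast_nonneg (α := ℝ) i])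
  push_cast
  rw [smul_eq_mul]
  split_ifs
  · field_simp
  · field_simp
    ring

theorem log_log_succ_bounds {y : ℝ} (hy : 2 ≤ y) :
    1 / ((y + 1) * Real.log (y + 1)) ≤ Real.log (Real.log (y + 1)) - Real.log (Real.log y) ∧
      Real.log (Real.log (y + 1)) - Real.log (Real.log y) ≤ 1 / (y * Real.log y) := by
  have hl : 0 < Real.log y := Real.log_pos (by linarith)
  have hl1 : 0 < Real.log (y + 1) := Real.log_pos (by linarith)
  have key : ∀ {u v : ℝ}, 0 < u → 0 < v →
      1 - u / v ≤ Real.log v - Real.log u ∧ Real.log v - Real.log u ≤ v / u - 1 := by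
    intro u v hu hv
    have h1 := Real.one_sub_inv_le_log_of_pos (div_pos hv hu)
    have h2 := Real.log_le_sub_one_of_pos (div_pos hv hu)
    rw [Real.log_div hv.ne' hu.ne'] at h1 h2
    rw [inv_div] at h1
    exact ⟨h1, h2⟩
  have hinner := key (by linarith : 0 < y) (by linarith : 0 < y + 1)
  have houter := key hl hl1
  have e1 : 1 - y / (y + 1) = 1 / (y + 1) := by field_simp; ring
  have e2 : (y + 1) / y - 1 = 1 / y := by field_simp; ring
  rw [e1, e2] at hinner
  constructor
  · refine le_trans ?_ houter.1
    calc 1 / ((y + 1) * Real.log (y + 1)) = 1 / (y + 1) / Real.log (y + 1) := by rw [div_div]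
      _ ≤ (Real.log (y + 1) - Real.log y) / Real.log (y + 1) := by gcongr; exact hinner.1
      _ = _ := by field_simp
  · refine le_trans houter.2 ?_
    calc Real.log (y + 1) / Real.log y - 1
        = (Real.log (y + 1) - Real.log y) / Real.log y := by field_simp
      _ ≤ 1 / y / Real.log y := by gcongr; exact hinner.2
      _ = _ := by rw [div_div]

theorem exists_tendsto_log_log_sub_sum_inv_mul_log :
    ∃ c : ℝ, Filter.Tendsto (fun N : ℕ => Real.log (Real.log (N + 2)) -
      ∑ i ∈ Finset.range N, 1 / ((i + 2 : ℝ) * Real.log (i + 2))) Filter.atTop (nhds c) := by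
  set d : ℕ → ℝ := fun N => Real.log (Real.log (N + 2)) -
      ∑ i ∈ Finset.range N, 1 / ((i + 2 : ℝ) * Real.log (i + 2)) with hd
  have hstep : ∀ N : ℕ, d (N + 1) ≤ d N ∧ 1 / ((N + 1 + 2 : ℝ) * Real.log (N + 1 + 2))
      - 1 / ((N + 2 : ℝ) * Real.log (N + 2)) ≤ d (N + 1) - d N := by
    intro N
    have h := log_log_succ_bounds (y := N + 2) (by linarith [Nat.cast_nonneg (α := ℝ) N])
    have e : (N : ℝ) + 2 + 1 = N + 1 + 2 := by ring
    rw [e] at h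
    simp only [hd, Finset.sum_range_succ]
    push_cast
    constructor <;> linarith [h.1, h.2]
  have hlow : ∀ N : ℕ, d 0 - 1 / (2 * Real.log 2) + 1 / ((N + 2 : ℝ) * Real.log (N + 2)) ≤ d N := by
    intro N
    induction N with
    | zero => simp
    | succ n ih => have := (hstep n).2; push_cast at this ⊢; linarith
  refine ⟨_, tendsto_atTop_ciInf (antitone_nat_of_succ_le fun N => (hstep N).1)
    ⟨d 0 - 1 / (2 * Real.log 2), ?_⟩⟩
  rintro _ ⟨N, rfl⟩
  have hN : 0 < Real.log (N + 2 : ℝ) := Real.log_pos (by linarith [Nat.cast_nonneg (α := ℝ) N])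
  have : 0 ≤ 1 / ((N + 2 : ℝ) * Real.log (N + 2)) := by positivity
  linarith [hlow N]

theorem exists_tendsto_primeHarmonic_sub_log_log :
    ∃ c : ℝ, Filter.Tendsto (fun N : ℕ => primeHarmonic N - Real.log (Real.log (N + 1)))
      Filter.atTop (nhds c) := by
  obtain ⟨c₁, h₁⟩ := exists_tendsto_sum_primes_sub_inv_mul_log
  obtain ⟨c₂, h₂⟩ := exists_tendsto_log_log_sub_sum_inv_mul_log
  refine ⟨c₁ - c₂, (Filter.tendsto_add_atTop_iff_nat 1).1 ((h₁.sub h₂).congr fun N => ?_)⟩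
  push_cast
  rw [show (N : ℝ) + 1 + 1 = N + 2 by ring]
  ring

theorem tendsto_log_sub_log_of_le_add {f : ℝ → ℝ} {K : ℝ}
    (h₁ : ∀ᶠ t in Filter.atTop, t ≤ f t) (h₂ : ∀ᶠ t in Filter.atTop, f t ≤ t + K) :
    Filter.Tendsto (fun t => Real.log (f t) - Real.log t) Filter.atTop (nhds 0) := by
  refine tendsto_of_tendsto_of_tendsto_of_le_of_le' tendsto_const_nhds
    (Filter.tendsto_id.const_div_atTop K) ?_ ?_
  · filter_upwards [h₁, Filter.eventually_gt_atTop 0] with t ht ht0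
    exact sub_nonneg.2 (Real.log_le_log ht0 ht)
  · filter_upwards [h₁, h₂, Filter.eventually_gt_atTop 0] with t ht ht' ht0
    have hf : 0 < f t := ht0.trans_le ht
    rw [← Real.log_div hf.ne' ht0.ne']
    refine (Real.log_le_sub_one_of_pos (div_pos hf ht0)).trans ?_
    rw [id, div_sub_one ht0.ne']
    gcongr
    linarith

theorem exists_tendsto_primeHarmonic_floor_exp_sub_log :
    ∃ c : ℝ, Filter.Tendsto (fun t : ℝ => primeHarmonic ⌊Real.exp t⌋₊ - Real.log t)
      Filter.atTop (nhds c) := by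
  obtain ⟨c, hc⟩ := exists_tendsto_primeHarmonic_sub_log_log
  have h₁ := hc.comp (tendsto_nat_floor_atTop.comp Real.tendsto_exp_atTop)
  have h₂ := tendsto_log_sub_log_of_le_add (f := fun t => Real.log (⌊Real.exp t⌋₊ + 1))
    (K := Real.log 2)
    (Filter.Eventually.of_forall fun t => by
      rw [Real.le_log_iff_exp_le (by positivity)]
      exact (Nat.lt_floor_add_one _).le)
    (by
      filter_upwards [Filter.eventually_ge_atTop 0] with t ht
      have h := Nat.floor_le (Real.exp_pos t).le
      rw [Real.log_le_iff_le_exp (by positivity), Real.exp_add, Real.exp_log two_pos]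
      linarith [Real.one_le_exp ht])
  refine ⟨c, by simpa using (h₁.add h₂)⟩

theorem tendsto_harmonic_floor_sub_log :
    Filter.Tendsto (fun t : ℝ => (harmonic ⌊t⌋₊ : ℝ) - Real.log t)
      Filter.atTop (nhds Real.eulerMascheroniConstant) := by
  have h₁ := Real.tendsto_eulerMascheroniSeq.comp (tendsto_nat_floor_atTop (α := ℝ))
  have h₂ := tendsto_log_sub_log_of_le_add (f := fun t => (⌊t⌋₊ + 1 : ℝ)) (K := 1)
    (Filter.Eventually.of_forall fun t => (Nat.lt_floor_add_one _).le)
    (by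
      filter_upwards [Filter.eventually_ge_atTop 0] with t ht
      linarith [Nat.floor_le ht])
  simpa [Real.eulerMascheroniSeq, Function.comp_def] using h₁.add h₂

theorem primeHarmonic_mono : Monotone primeHarmonic := by
  intro m n hmn
  refine Finset.sum_le_sum_of_subset_of_nonneg (Finset.range_mono (by omega)) fun i _ _ => ?_
  split_ifs <;> positivity

theorem primeHarmonic_nonneg (N : ℕ) : 0 ≤ primeHarmonic N :=
  Finset.sum_nonneg fun i _ => by split_ifs <;> positivity

theorem harmonic_cast_mono : Monotone fun n : ℕ => (harmonic n : ℝ) := by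
  intro m n hmn
  simp only [harmonic]
  push_cast
  exact Finset.sum_le_sum_of_subset_of_nonneg (Finset.range_mono hmn) fun i _ _ => by positivity

theorem exists_bound_primeHarmonic_sub_harmonic {l : ℝ}
    (h : Filter.Tendsto (fun t : ℝ => primeHarmonic ⌊Real.exp t⌋₊ - (harmonic ⌊t⌋₊ : ℝ))
      Filter.atTop (nhds l)) :
    ∃ C : ℝ, ∀ t : ℝ, |primeHarmonic ⌊Real.exp t⌋₊ - (harmonic ⌊t⌋₊ : ℝ)| ≤ C := by
  obtain ⟨T, hT⟩ := Filter.eventually_atTop.1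
    (h.abs.eventually (gt_mem_nhds (lt_add_one |l|)))
  have hH : ∀ n : ℕ, (0 : ℝ) ≤ harmonic n := fun n => by
    simpa using harmonic_cast_mono (Nat.zero_le n)
  refine ⟨max (|l| + 1) (primeHarmonic ⌊Real.exp T⌋₊ + harmonic ⌊T⌋₊), fun t => ?_⟩
  rcases le_total T t with ht | ht
  · exact (hT t ht).le.trans (le_max_left _ _)
  · refine le_trans ?_ (le_max_right _ _)
    have h₁ := primeHarmonic_mono (Nat.floor_le_floor (Real.exp_le_exp.2 ht))
    have h₂ := harmonic_cast_mono (Nat.floor_le_floor ht)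
    have h₃ := primeHarmonic_nonneg ⌊Real.exp t⌋₊
    have h₄ := hH ⌊t⌋₊
    simp only at h₂
    rw [abs_le]
    constructor <;> linarith [hH ⌊T⌋₊, primeHarmonic_nonneg ⌊Real.exp T⌋₊]

theorem integrableOn_exp_neg_mul_step {l : ℝ} (a : ℝ) :
    MeasureTheory.IntegrableOn (fun u => Real.exp (-u) * if l ≤ u then a else 0) (Set.Ioi 0) := by
  have : (fun u => Real.exp (-u) * if l ≤ u then a else 0) =
      (Set.Ici l).indicator fun u => Real.exp (-u) * a := by
    ext u
    simp [Set.indicator_apply]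
  rw [this]
  exact MeasureTheory.Integrable.indicator
    ((integrableOn_exp_neg_Ioi 0).mul_const a) measurableSet_Ici

theorem integral_exp_neg_mul_step {l : ℝ} (hl : 0 ≤ l) (a : ℝ) :
    ∫ u in Set.Ioi (0 : ℝ), Real.exp (-u) * (if l ≤ u then a else 0) = a * Real.exp (-l) := by
  have : (fun u => Real.exp (-u) * if l ≤ u then a else 0) =
      (Set.Ici l).indicator fun u => Real.exp (-u) * a := by
    ext u
    simp [Set.indicator_apply]
  rw [this, MeasureTheory.integral_indicator measurableSet_Ici,
    MeasureTheory.Measure.restrict_restrict measurableSet_Ici,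
    MeasureTheory.setIntegral_congr_set (t := Set.Ioi l), MeasureTheory.integral_mul_const,
    integral_exp_neg_Ioi, mul_comm]
  rcases hl.eq_or_lt with rfl | hl
  · rw [Set.inter_eq_right.2 Set.Ioi_subset_Ici_self]
    exact Filter.EventuallyEq.rfl
  · rw [Set.inter_eq_left.2 (Set.Ici_subset_Ioi.2 hl)]
    exact MeasureTheory.Ioi_ae_eq_Ici.symm

theorem tsum_prime_step_sub_step {σ u : ℝ} (hσ : 0 < σ) (hu : 0 < u) :
    ∑' n : ℕ, ((if σ * Real.log n ≤ u then (if n.Prime then (1 / n : ℝ) else 0) else 0) -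
        (if σ * n ≤ u then (1 / n : ℝ) else 0)) =
      primeHarmonic ⌊Real.exp (u / σ)⌋₊ - (harmonic ⌊u / σ⌋₊ : ℝ) := by
  have h₁ : HasSum (fun n : ℕ => if σ * Real.log n ≤ u then
      (if n.Prime then (1 / n : ℝ) else 0) else 0) (primeHarmonic ⌊Real.exp (u / σ)⌋₊) := by
    have hiff : ∀ n : ℕ, n.Prime →
        (σ * Real.log n ≤ u ↔ n ∈ Finset.range (⌊Real.exp (u / σ)⌋₊ + 1)) := by
      intro n hn
      rw [Finset.mem_range, Nat.lt_succ_iff, Nat.le_floor_iff (Real.exp_pos _).le, mul_comm,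
        ← le_div_iff₀ hσ, Real.log_le_iff_le_exp (by exact_mod_cast hn.pos)]
    have := hasSum_sum_of_ne_finset_zero (L := .unconditional ℕ)
      (f := fun n : ℕ => if σ * Real.log n ≤ u then
        (if n.Prime then (1 / n : ℝ) else 0) else 0)
      (s := Finset.range (⌊Real.exp (u / σ)⌋₊ + 1))
      (by
        intro n hn
        by_cases hp : n.Prime
        · rw [if_neg (fun h => hn ((hiff n hp).1 h))]
        · simp [hp])
    convert this using 1
    refine Finset.sum_congr rfl fun n hn => ?_
    by_cases hp : n.Prime
    · rw [if_pos ((hiff n hp).2 hn)]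
    · simp [hp]
  have h₂ : HasSum (fun n : ℕ => if σ * n ≤ u then (1 / n : ℝ) else 0)
      (harmonic ⌊u / σ⌋₊ : ℝ) := by
    have hiff : ∀ n : ℕ, σ * n ≤ u ↔ n ∈ Finset.range (⌊u / σ⌋₊ + 1) := by
      intro n
      rw [Finset.mem_range, Nat.lt_succ_iff, Nat.le_floor_iff (by positivity), mul_comm,
        ← le_div_iff₀ hσ]
    have := hasSum_sum_of_ne_finset_zero (L := .unconditional ℕ)
      (f := fun n : ℕ => if σ * n ≤ u then (1 / n : ℝ) else 0)
      (s := Finset.range (⌊u / σ⌋₊ + 1)) (fun n hn => if_neg fun h => hn ((hiff n).1 h))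
    convert this using 1
    rw [Finset.sum_congr rfl fun n hn => if_pos ((hiff n).2 hn), Finset.sum_range_succ', harmonic]
    simp
  exact (h₁.sub h₂).tsum_eq

theorem summable_prime_exp_log {σ : ℝ} (hσ : 0 < σ) :
    Summable fun n : ℕ => (if n.Prime then (1 / n : ℝ) else 0) * Real.exp (-(σ * Real.log n)) := by
  refine Summable.of_nonneg_of_le (fun n => by split_ifs <;> positivity) (fun n => ?_)
    (Real.summable_nat_rpow.2 (by linarith : -1 - σ < -1))
  split_ifs with hp
  · have hn : (0 : ℝ) < n := by exact_mod_cast hp.pos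
    rw [Real.rpow_def_of_pos hn, one_div, ← Real.exp_log (inv_pos.2 hn), ← Real.exp_add,
      Real.log_inv]
    exact Real.exp_le_exp.2 (by linarith)
  · rw [zero_mul]
    positivity

theorem summable_inv_mul_exp_neg {σ : ℝ} (hσ : 0 < σ) :
    Summable fun n : ℕ => (1 / n : ℝ) * Real.exp (-(σ * n)) := by
  refine Summable.of_nonneg_of_le (fun n => by positivity) (fun n => ?_)
    (summable_geometric_of_lt_one (Real.exp_pos (-σ)).le (Real.exp_lt_one_iff.2 (by linarith)))
  rw [← Real.exp_nat_mul, show (n : ℝ) * -σ = -(σ * n) by ring]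
  refine mul_le_of_le_one_left (Real.exp_pos _).le ?_
  rcases Nat.eq_zero_or_pos n with rfl | hn
  · simp
  · rw [div_le_one (by positivity)]
    exact_mod_cast hn

theorem tsum_prime_sub_inv_eq_integral {σ : ℝ} (hσ : 0 < σ) :
    ∑' n : ℕ, ((if n.Prime then (1 / n : ℝ) else 0) * Real.exp (-(σ * Real.log n)) -
        (1 / n : ℝ) * Real.exp (-(σ * n))) =
      ∫ u in Set.Ioi (0 : ℝ), Real.exp (-u) *
        (primeHarmonic ⌊Real.exp (u / σ)⌋₊ - (harmonic ⌊u / σ⌋₊ : ℝ)) := by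
  set F : ℕ → ℝ → ℝ := fun n u =>
    Real.exp (-u) * (if σ * Real.log n ≤ u then (if n.Prime then (1 / n : ℝ) else 0) else 0) -
      Real.exp (-u) * (if σ * n ≤ u then (1 / n : ℝ) else 0) with hF
  have hlog : ∀ n : ℕ, 0 ≤ σ * Real.log n := fun n =>
    mul_nonneg hσ.le (Real.log_natCast_nonneg n)
  have hint : ∀ n, MeasureTheory.Integrable (F n)
      (MeasureTheory.volume.restrict (Set.Ioi (0 : ℝ))) := fun n =>
    (integrableOn_exp_neg_mul_step _).sub (integrableOn_exp_neg_mul_step _)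
  have hsum : Summable fun n => ∫ u in Set.Ioi (0 : ℝ), ‖F n u‖ := by
    refine Summable.of_nonneg_of_le (fun n => by positivity) (fun n => ?_)
      ((summable_prime_exp_log hσ).add (summable_inv_mul_exp_neg hσ))
    rw [← integral_exp_neg_mul_step (hlog n),
      ← integral_exp_neg_mul_step (by positivity : 0 ≤ σ * (n : ℝ)),
      ← MeasureTheory.integral_add (integrableOn_exp_neg_mul_step _)
        (integrableOn_exp_neg_mul_step _)]
    refine MeasureTheory.integral_mono (hint n).norm
      ((integrableOn_exp_neg_mul_step _).add (integrableOn_exp_neg_mul_step _)) fun u => ?_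
    refine (norm_sub_le _ _).trans (le_of_eq ?_)
    rw [Real.norm_of_nonneg, Real.norm_of_nonneg]
    · split_ifs <;> positivity
    · split_ifs <;> positivity
  have h := MeasureTheory.hasSum_integral_of_summable_integral_norm hint hsum
  have hval : ∀ n, ∫ u in Set.Ioi (0 : ℝ), F n u =
      (if n.Prime then (1 / n : ℝ) else 0) * Real.exp (-(σ * Real.log n)) -
        (1 / n : ℝ) * Real.exp (-(σ * n)) := fun n => by
    rw [← integral_exp_neg_mul_step (hlog n),
      ← integral_exp_neg_mul_step (by positivity : 0 ≤ σ * (n : ℝ)),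
      ← MeasureTheory.integral_sub (integrableOn_exp_neg_mul_step _)
        (integrableOn_exp_neg_mul_step _)]
  simp only [hval] at h
  rw [h.tsum_eq]
  refine MeasureTheory.setIntegral_congr_fun measurableSet_Ioi fun u hu => ?_
  simp only [hF]
  rw [← tsum_prime_step_sub_step hσ hu, ← tsum_mul_left]
  simp only [mul_sub]

theorem tendsto_tsum_prime_sub_inv {l : ℝ}
    (h : Filter.Tendsto (fun t : ℝ => primeHarmonic ⌊Real.exp t⌋₊ - (harmonic ⌊t⌋₊ : ℝ))
      Filter.atTop (nhds l)) :
    Filter.Tendsto (fun σ : ℝ => ∑' n : ℕ,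
      ((if n.Prime then (1 / n : ℝ) else 0) * Real.exp (-(σ * Real.log n)) -
        (1 / n : ℝ) * Real.exp (-(σ * n)))) (nhdsWithin 0 (Set.Ioi 0)) (nhds l) := by
  obtain ⟨C, hC⟩ := exists_bound_primeHarmonic_sub_harmonic h
  have hlim : ∫ u in Set.Ioi (0 : ℝ), Real.exp (-u) * l = l := by
    rw [MeasureTheory.integral_mul_const, integral_exp_neg_Ioi]
    simp
  have hmeas : Measurable fun t : ℝ => primeHarmonic ⌊Real.exp t⌋₊ - (harmonic ⌊t⌋₊ : ℝ) :=
    ((measurable_from_nat (f := primeHarmonic)).comp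
      (Nat.measurable_floor.comp Real.measurable_exp)).sub
      ((measurable_from_nat (f := fun n => (harmonic n : ℝ))).comp Nat.measurable_floor)
  rw [← hlim]
  refine (MeasureTheory.tendsto_integral_filter_of_dominated_convergence
    (F := fun σ u => Real.exp (-u) *
      (primeHarmonic ⌊Real.exp (u / σ)⌋₊ - (harmonic ⌊u / σ⌋₊ : ℝ)))
    (fun u => Real.exp (-u) * C) ?_ ?_ ((integrableOn_exp_neg_Ioi 0).mul_const C) ?_).congr' ?_
  · exact Filter.Eventually.of_forall fun σ => (Measurable.mul (by fun_prop)
      (hmeas.comp (measurable_id.div_const σ))).aestronglyMeasurable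
  · refine Filter.Eventually.of_forall fun σ => Filter.Eventually.of_forall fun u => ?_
    rw [norm_mul, Real.norm_of_nonneg (Real.exp_pos _).le]
    exact mul_le_mul_of_nonneg_left (hC _) (Real.exp_pos _).le
  · filter_upwards [MeasureTheory.ae_restrict_mem measurableSet_Ioi] with u hu
    refine (h.comp ?_).const_mul _
    exact (tendsto_inv_nhdsGT_zero.const_mul_atTop hu).congr fun σ => (div_eq_mul_inv u σ).symm
  · filter_upwards [self_mem_nhdsWithin] with σ hσ
    exact (tsum_prime_sub_inv_eq_integral hσ).symm

theorem tsum_inv_mul_exp_neg {σ : ℝ} (hσ : 0 < σ) :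
    ∑' n : ℕ, (1 / n : ℝ) * Real.exp (-(σ * n)) = -Real.log (1 - Real.exp (-σ)) := by
  have h := Real.hasSum_pow_div_log_of_abs_lt_one (x := Real.exp (-σ))
    (by rw [abs_of_pos (Real.exp_pos _)]; exact Real.exp_lt_one_iff.2 (by linarith))
  rw [← h.tsum_eq, (summable_inv_mul_exp_neg hσ).tsum_eq_zero_add]
  simp only [Nat.cast_zero, div_zero, zero_mul, zero_add]
  refine tsum_congr fun n => ?_
  rw [← Real.exp_nat_mul]
  push_cast
  rw [show ((n : ℝ) + 1) * -σ = -(σ * (n + 1)) by ring]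
  ring

theorem tsum_prime_exp_log {σ : ℝ} :
    ∑' n : ℕ, (if n.Prime then (1 / n : ℝ) else 0) * Real.exp (-(σ * Real.log n)) =
      ∑' p : Nat.Primes, (p : ℝ) ^ (-(1 + σ)) := by
  have h := tsum_subtype {n : ℕ | n.Prime} fun n : ℕ => (n : ℝ) ^ (-(1 + σ))
  refine Eq.trans (tsum_congr fun n => ?_) h.symm
  by_cases hp : n.Prime
  · have hn : (0 : ℝ) < n := by exact_mod_cast hp.pos
    rw [if_pos hp, Set.indicator_of_mem (by exact hp), Real.rpow_def_of_pos hn, one_div,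
      ← Real.exp_log (inv_pos.2 hn), ← Real.exp_add, Real.log_inv]
    congr 1
    ring
  · rw [if_neg hp, Set.indicator_of_notMem (by exact hp), zero_mul]

theorem hasSum_neg_log_one_sub_primes_rpow {s : ℝ} (hs : 1 < s) :
    HasSum (fun p : Nat.Primes => -Real.log (1 - (p : ℝ) ^ (-s)))
      (Real.log (∑' n : ℕ, 1 / (n : ℝ) ^ s)) := by
  let f : ℕ →*₀ ℝ :=
    { toFun := fun n => (n : ℝ) ^ (-s)
      map_zero' := by rw [Nat.cast_zero, Real.zero_rpow (by linarith)]
      map_one' := by simp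
      map_mul' := fun m n => by
        rw [Nat.cast_mul, Real.mul_rpow (Nat.cast_nonneg m) (Nat.cast_nonneg n)] }
  have hsum : Summable fun n : ℕ => (n : ℝ) ^ (-s) := Real.summable_nat_rpow.2 (by linarith)
  have hprod := EulerProduct.eulerProduct_completely_multiplicative_hasProd (f := f)
    (hsum.congr fun n => (Real.norm_of_nonneg (by positivity : 0 ≤ (n : ℝ) ^ (-s))).symm)
  have heq : ∑' n : ℕ, f n = ∑' n : ℕ, 1 / (n : ℝ) ^ s :=
    tsum_congr fun n => by
      rw [one_div, ← Real.rpow_neg (Nat.cast_nonneg n)]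
      rfl
  rw [heq] at hprod
  have hpos : 0 < ∑' n : ℕ, 1 / (n : ℝ) ^ s := by
    refine (Real.summable_one_div_nat_rpow.2 hs).tsum_pos (fun n => by positivity) 1 ?_
    simp
  have hlog := (Real.continuousAt_log hpos.ne').tendsto.comp hprod
  refine hlog.congr fun A => ?_
  have hlt : ∀ p : Nat.Primes, 0 < 1 - (p : ℝ) ^ (-s) := fun p =>
    sub_pos.2 (Real.rpow_lt_one_of_one_lt_of_neg (by exact_mod_cast p.2.one_lt) (by linarith))
  have hprod_log : Real.log (∏ p ∈ A, (1 - (p : ℝ) ^ (-s))⁻¹) =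
      ∑ p ∈ A, -Real.log (1 - (p : ℝ) ^ (-s)) := by
    rw [Real.log_prod fun p _ => (inv_pos.2 (hlt p)).ne']
    exact Finset.sum_congr rfl fun p _ => Real.log_inv _
  exact hprod_log

theorem neg_log_one_sub_sub_bounds {q : ℝ} (hq : q ≤ 1 / 2) :
    0 ≤ -Real.log (1 - q) - q ∧ -Real.log (1 - q) - q ≤ 2 * q ^ 2 := by
  have hpos : 0 < 1 - q := by linarith
  have h₁ := Real.log_le_sub_one_of_pos hpos
  have h₂ := Real.one_sub_inv_le_log_of_pos hpos
  have h₃ : (1 - q)⁻¹ - 1 - q = q ^ 2 * (1 - q)⁻¹ := by field_simp; ring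
  have h₄ : (1 - q)⁻¹ ≤ 2 := by rw [inv_le_comm₀ hpos two_pos]; linarith
  have h₅ : q ^ 2 * (1 - q)⁻¹ ≤ q ^ 2 * 2 := by gcongr
  constructor <;> linarith

theorem primes_rpow_le_half (p : Nat.Primes) {σ : ℝ} (hσ : 0 ≤ σ) :
    (p : ℝ) ^ (-(1 + σ)) ≤ 1 / p ∧ (1 / p : ℝ) ≤ 1 / 2 := by
  have hp : (2 : ℝ) ≤ p := by exact_mod_cast p.2.two_le
  constructor
  · rw [one_div, ← Real.rpow_neg_one]
    exact Real.rpow_le_rpow_of_exponent_le (by linarith) (by linarith)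
  · exact one_div_le_one_div_of_le two_pos hp

theorem summable_primes_two_mul_sq : Summable fun p : Nat.Primes => 2 * (1 / p : ℝ) ^ 2 := by
  refine Summable.mul_left 2 ((Nat.Primes.summable_rpow.2 (by norm_num : (-2 : ℝ) < -1)).congr
    fun p => ?_)
  rw [Real.rpow_neg (Nat.cast_nonneg _), one_div, inv_pow]
  norm_cast

theorem tendsto_tsum_neg_log_one_sub_sub :
    Filter.Tendsto (fun σ : ℝ => ∑' p : Nat.Primes,
      (-Real.log (1 - (p : ℝ) ^ (-(1 + σ))) - (p : ℝ) ^ (-(1 + σ))))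
      (nhdsWithin 0 (Set.Ioi 0))
      (nhds (∑' p : Nat.Primes, (-Real.log (1 - 1 / p) - 1 / p : ℝ))) := by
  refine tendsto_tsum_of_dominated_convergence summable_primes_two_mul_sq (fun p => ?_) ?_
  · have hp : (2 : ℝ) ≤ p := by exact_mod_cast p.2.two_le
    have hq : Filter.Tendsto (fun σ : ℝ => (p : ℝ) ^ (-(1 + σ))) (nhdsWithin 0 (Set.Ioi 0))
        (nhds (1 / p : ℝ)) := by
      have : Continuous fun σ : ℝ => (p : ℝ) ^ (-(1 + σ)) :=
        Real.continuous_const_rpow (by linarith : (p : ℝ) ≠ 0) |>.comp (by fun_prop)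
      have h := (this.tendsto 0).mono_left (nhdsWithin_le_nhds (s := Set.Ioi 0))
      rwa [add_zero, Real.rpow_neg_one, ← one_div] at h
    have hne : (1 - 1 / p : ℝ) ≠ 0 := by
      have := (primes_rpow_le_half p le_rfl).2
      linarith
    exact (((tendsto_const_nhds.sub hq).log hne).neg).sub hq
  · filter_upwards [self_mem_nhdsWithin] with σ hσ p
    have h := primes_rpow_le_half p (le_of_lt hσ)
    have hb := neg_log_one_sub_sub_bounds (h.1.trans h.2)
    rw [Real.norm_of_nonneg hb.1]
    have h0 : 0 ≤ (p : ℝ) ^ (-(1 + σ)) := by positivity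
    exact hb.2.trans (by gcongr; exact h.1)

theorem tsum_prime_sub_inv_eq {σ : ℝ} (hσ : 0 < σ) :
    ∑' n : ℕ, ((if n.Prime then (1 / n : ℝ) else 0) * Real.exp (-(σ * Real.log n)) -
        (1 / n : ℝ) * Real.exp (-(σ * n))) =
      Real.log ((σ * ∑' n : ℕ, 1 / (n : ℝ) ^ (1 + σ)) * ((1 - Real.exp (-σ)) / σ)) -
        ∑' p : Nat.Primes, (-Real.log (1 - (p : ℝ) ^ (-(1 + σ))) - (p : ℝ) ^ (-(1 + σ))) := by
  have hlog := hasSum_neg_log_one_sub_primes_rpow (by linarith : 1 < 1 + σ)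
  have hq : Summable fun p : Nat.Primes => (p : ℝ) ^ (-(1 + σ)) :=
    Nat.Primes.summable_rpow.2 (by linarith)
  have hpos : 0 < ∑' n : ℕ, 1 / (n : ℝ) ^ (1 + σ) := by
    refine (Real.summable_one_div_nat_rpow.2 (by linarith)).tsum_pos (fun n => by positivity) 1 ?_
    simp
  have hexp : 0 < 1 - Real.exp (-σ) := sub_pos.2 (Real.exp_lt_one_iff.2 (by linarith))
  rw [(summable_prime_exp_log hσ).tsum_sub (summable_inv_mul_exp_neg hσ),
    tsum_inv_mul_exp_neg hσ, tsum_prime_exp_log, hlog.summable.tsum_sub hq, hlog.tsum_eq,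
    show (σ * ∑' n : ℕ, 1 / (n : ℝ) ^ (1 + σ)) * ((1 - Real.exp (-σ)) / σ) =
      (∑' n : ℕ, 1 / (n : ℝ) ^ (1 + σ)) * (1 - Real.exp (-σ)) by field_simp,
    Real.log_mul hpos.ne' hexp.ne']
  ring

theorem tendsto_one_sub_exp_neg_div :
    Filter.Tendsto (fun σ : ℝ => (1 - Real.exp (-σ)) / σ) (nhdsWithin 0 (Set.Ioi 0)) (nhds 1) := by
  have h : HasDerivAt (fun σ : ℝ => 1 - Real.exp (-σ)) 1 0 := by
    simpa using ((hasDerivAt_neg (0 : ℝ)).exp).const_sub 1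
  refine (h.tendsto_slope_zero.mono_left (nhdsGT_le_nhdsNE 0)).congr fun σ => ?_
  simp [div_eq_inv_mul]

theorem tendsto_primeHarmonic_floor_exp_sub_log :
    Filter.Tendsto (fun t : ℝ => primeHarmonic ⌊Real.exp t⌋₊ - Real.log t) Filter.atTop
      (nhds (Real.eulerMascheroniConstant -
        ∑' p : Nat.Primes, (-Real.log (1 - 1 / p) - 1 / p : ℝ))) := by
  obtain ⟨c, hc⟩ := exists_tendsto_primeHarmonic_floor_exp_sub_log
  have hl := tendsto_tsum_prime_sub_inv
    ((hc.sub tendsto_harmonic_floor_sub_log).congr fun t => by ring)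
  have hshift : Filter.Tendsto (fun σ : ℝ => 1 + σ) (nhdsWithin 0 (Set.Ioi 0))
      (nhdsWithin 1 (Set.Ioi 1)) := by
    refine tendsto_nhdsWithin_iff.2 ⟨?_, ?_⟩
    · have : Continuous fun σ : ℝ => 1 + σ := by fun_prop
      simpa using (this.tendsto 0).mono_left (nhdsWithin_le_nhds (s := Set.Ioi 0))
    · filter_upwards [self_mem_nhdsWithin] with σ hσ
      simpa using hσ
  have hz := tendsto_sub_mul_tsum_nat_rpow.comp hshift
  simp only [Function.comp_def, add_sub_cancel_left] at hz
  have hr := (((hz.mul tendsto_one_sub_exp_neg_div).log (by norm_num)).sub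
    tendsto_tsum_neg_log_one_sub_sub).congr' (by
      filter_upwards [self_mem_nhdsWithin] with σ hσ
      exact (tsum_prime_sub_inv_eq hσ).symm)
  have huniq := tendsto_nhds_unique hl hr
  rw [mul_one, Real.log_one] at huniq
  convert hc using 2
  linarith

theorem eventually_prod_primes_inv_le {η : ℝ} (hη : 0 < η) :
    ∀ᶠ x : ℝ in Filter.atTop,
      ∏ p ∈ (Finset.range (⌊x⌋₊ + 1)).filter Nat.Prime, (1 - 1 / p : ℝ)⁻¹ ≤
        Real.exp (Real.eulerMascheroniConstant + η) * Real.log x := by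
  have h := (tendsto_primeHarmonic_floor_exp_sub_log.comp Real.tendsto_log_atTop).eventually
    (gt_mem_nhds (lt_add_of_pos_right _ hη))
  filter_upwards [h, Filter.eventually_gt_atTop 1] with x hx hx1
  simp only [Function.comp_apply, Real.exp_log (zero_lt_one.trans hx1)] at hx
  have hhalf : ∀ p : ℕ, p.Prime → (1 / p : ℝ) ≤ 1 / 2 := fun p hp =>
    one_div_le_one_div_of_le two_pos (by exact_mod_cast hp.two_le)
  have hsum : ∑ p ∈ (Finset.range (⌊x⌋₊ + 1)).filter Nat.Prime,
      (-Real.log (1 - 1 / p) - 1 / p : ℝ) ≤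
      ∑' p : Nat.Primes, (-Real.log (1 - 1 / p) - 1 / p : ℝ) := by
    rw [← Finset.sum_subtype_eq_sum_filter]
    refine Summable.sum_le_tsum (f := fun p : Nat.Primes => (-Real.log (1 - 1 / p) - 1 / p : ℝ)) _
      (fun p _ => (neg_log_one_sub_sub_bounds (hhalf p p.2)).1) ?_
    exact Summable.of_nonneg_of_le (fun p => (neg_log_one_sub_sub_bounds (hhalf p p.2)).1)
      (fun p => (neg_log_one_sub_sub_bounds (hhalf p p.2)).2) summable_primes_two_mul_sq
  have hprod : ∏ p ∈ (Finset.range (⌊x⌋₊ + 1)).filter Nat.Prime, (1 - 1 / p : ℝ)⁻¹ =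
      Real.exp (primeHarmonic ⌊x⌋₊ + ∑ p ∈ (Finset.range (⌊x⌋₊ + 1)).filter Nat.Prime,
        (-Real.log (1 - 1 / p) - 1 / p : ℝ)) := by
    rw [primeHarmonic, ← Finset.sum_filter, ← Finset.sum_add_distrib, Real.exp_sum]
    refine Finset.prod_congr rfl fun p hp => ?_
    have := hhalf p (Finset.mem_filter.1 hp).2
    rw [add_sub_cancel, Real.exp_neg, Real.exp_log (by linarith)]
  have hlogx : 0 < Real.log x := Real.log_pos hx1
  rw [hprod, ← Real.exp_log hlogx, ← Real.exp_add, Real.exp_le_exp]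
  linarith

/-- The primes in `(X, R]` that do not divide `m`. -/
def siftingPrimes (X R : ℕ) (m : ℤ) : Finset ℕ :=
  (Finset.range (R + 1)).filter fun p => p.Prime ∧ X < p ∧ ¬ (p : ℤ) ∣ m

theorem mem_siftingPrimes {X R p : ℕ} {m : ℤ} :
    p ∈ siftingPrimes X R m ↔ p ≤ R ∧ p.Prime ∧ X < p ∧ ¬ (p : ℤ) ∣ m := by
  simp [siftingPrimes]

theorem le_of_prime_of_dvd {Q p : ℕ} {z c : ℤ} (hQ : 0 < Q) (hp : p.Prime) (hz : 0 < z)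
    (hc : 1 ≤ c) (hprime : Prime ((Q : ℤ) * z + c)) (hdvd : (p : ℤ) ∣ (Q : ℤ) * z + c) :
    z ≤ p := by
  have hQz : z ≤ Q * z := le_mul_of_one_le_left hz.le (by exact_mod_cast hQ)
  have hassoc := (Nat.prime_iff_prime_int.1 hp).associated_of_dvd hprime hdvd
  rcases Int.associated_iff.1 hassoc with h | h <;> omega

theorem card_prime_pairs_le {X Q R N : ℕ} {a b : ℤ} {δ : ℝ} (hδ : 0 ≤ δ) (hX : 4 ≤ X)
    (h4 : ∀ p : ℕ, X < p → 4 ≤ (p : ℝ) ^ δ) (hQ0 : 0 < Q)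
    (hQ : ∀ p : ℕ, p.Prime → X < p → ¬ p ∣ Q) (ha : 1 ≤ a) (hb : 1 ≤ b) (hR : 1 ≤ R)
    (S : Finset ℤ)
    (hS : ∀ z ∈ S, 0 < z ∧ z ≤ N ∧ Prime ((Q : ℤ) * z + a) ∧ Prime ((Q : ℤ) * z + b)) :
    (S.card : ℝ) ≤ R + (N / (∑ A ∈ primeSubsets (siftingPrimes X R (a - b)) R,
      ∏ p ∈ A, (2 / p : ℝ) / (1 - 2 / p)) + (R * (R : ℝ) ^ δ) ^ 2) := by
  have hex : ∀ p : ℕ, ∃ s : ℤ, p ∈ siftingPrimes X R (a - b) → (Q : ℤ) * s ≡ 1 [ZMOD p] := by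
    intro p
    by_cases hp : p ∈ siftingPrimes X R (a - b)
    · have hp' := mem_siftingPrimes.1 hp
      obtain ⟨s, hs⟩ := Int.mod_coprime
        ((hp'.2.1.coprime_iff_not_dvd).2 (hQ p hp'.2.1 hp'.2.2.1)).symm
      exact ⟨s, fun _ => hs⟩
    · exact ⟨0, fun h => absurd h hp⟩
  choose s hs using hex
  have hroot : ∀ p ∈ siftingPrimes X R (a - b), ∀ c : ℤ, (Q : ℤ) * (-c * s p) ≡ -c [ZMOD p] := by
    intro p hp c
    have := (hs p hp).mul_left (-c)
    rw [mul_one] at this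
    convert this using 1
    ring
  have hdvd : ∀ p ∈ siftingPrimes X R (a - b), ∀ c z : ℤ, z ≡ -c * s p [ZMOD p] →
      (p : ℤ) ∣ Q * z + c := by
    intro p hp c z hz
    have h := ((hz.mul_left (Q : ℤ)).trans (hroot p hp c)).add_right c
    rw [neg_add_cancel] at h
    exact Int.modEq_zero_iff_dvd.1 h
  have hsieve := card_two_classes_sieve_le (P := siftingPrimes X R (a - b))
    (fun p hp => (mem_siftingPrimes.1 hp).2.1)
    (fun p hp => by have := (mem_siftingPrimes.1 hp).2.2.1; omega) hδ
    (fun p hp => h4 p (mem_siftingPrimes.1 hp).2.2.1) N R hR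
    (fun p => -a * s p) (fun p => -b * s p) (fun p hp h => by
      have h' := ((hroot p hp a).symm.trans (h.mul_left (Q : ℤ))).trans (hroot p hp b)
      refine (mem_siftingPrimes.1 hp).2.2.2 ?_
      have h₃ := h'.dvd
      rwa [neg_sub_neg] at h₃)
  refine le_trans ?_ (add_le_add_right hsieve (R : ℝ))
  have hsub : S ⊆ Finset.Ioc (0 : ℤ) R ∪ (Finset.Ioc (0 : ℤ) N).filter fun z =>
      ∀ p ∈ siftingPrimes X R (a - b),
        ¬ (z ≡ -a * s p [ZMOD p] ∨ z ≡ -b * s p [ZMOD p]) := by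
    intro z hz
    obtain ⟨hz0, hzN, hza, hzb⟩ := hS z hz
    rw [Finset.mem_union, Finset.mem_filter, Finset.mem_Ioc, Finset.mem_Ioc]
    by_cases h : ∀ p ∈ siftingPrimes X R (a - b),
        ¬ (z ≡ -a * s p [ZMOD p] ∨ z ≡ -b * s p [ZMOD p])
    · exact Or.inr ⟨⟨hz0, hzN⟩, h⟩
    · push Not at h
      obtain ⟨p, hp, h⟩ := h
      have hp' := mem_siftingPrimes.1 hp
      have hzp : z ≤ p := by
        rcases h with h | h
        · exact le_of_prime_of_dvd hQ0 hp'.2.1 hz0 ha hza (hdvd p hp a z h)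
        · exact le_of_prime_of_dvd hQ0 hp'.2.1 hz0 hb hzb (hdvd p hp b z h)
      exact Or.inl ⟨hz0, hzp.trans (by exact_mod_cast hp'.1)⟩
  have hcard := (Finset.card_le_card hsub).trans (Finset.card_union_le _ _)
  rw [Int.card_Ioc, sub_zero, Int.toNat_natCast] at hcard
  exact_mod_cast hcard

theorem prod_large_primes_inv_le {x : ℝ} (hx : 2 ≤ x) {T : Finset ℕ} (hT : ∀ p ∈ T, x < p)
    (hprod : ((∏ p ∈ T, p : ℕ) : ℝ) ≤ 4 ^ x) :
    ∏ p ∈ T, (1 - 1 / p : ℝ)⁻¹ ≤ Real.exp (2 * Real.log 4 / Real.log x) := by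
  have hlogx : 0 < Real.log x := Real.log_pos (by linarith)
  have hcard : T.card * Real.log x ≤ x * Real.log 4 := by
    rw [← Real.log_pow, ← Real.log_rpow (by norm_num)]
    refine Real.log_le_log (by positivity) (le_trans ?_ hprod)
    rw [← Finset.prod_const, Nat.cast_prod]
    exact Finset.prod_le_prod (fun p _ => by linarith) fun p hp => (hT p hp).le
  have hfactor : ∀ p ∈ T, (1 - 1 / p : ℝ)⁻¹ ≤ Real.exp (2 / x) := by
    intro p hp
    have hxp := hT p hp
    have hq : (1 / p : ℝ) ≤ 1 / x := one_div_le_one_div_of_le (by linarith) hxp.le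
    have hq2 : 1 / x ≤ 1 / 2 := one_div_le_one_div_of_le two_pos hx
    have hpos : (0 : ℝ) < 1 / p := by
      have : (0 : ℝ) < p := by linarith
      positivity
    have h1 := Real.add_one_le_exp (2 / x)
    refine le_trans ?_ h1
    rw [inv_le_comm₀ (by linarith) (by positivity)]
    refine le_trans ?_ (sub_le_sub_left hq 1)
    rw [inv_le_iff_one_le_mul₀ (by positivity)]
    have e : 2 / x = 2 * (1 / x) := by ring
    rw [e]
    have : 0 < 1 / x := by positivity
    nlinarith
  calc ∏ p ∈ T, (1 - 1 / p : ℝ)⁻¹ ≤ ∏ _p ∈ T, Real.exp (2 / x) := by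
        refine Finset.prod_le_prod (fun p hp => ?_) hfactor
        have : (1 : ℝ) ≤ p := by linarith [hT p hp]
        exact inv_nonneg.2 (sub_nonneg.2 (div_le_one_of_le₀ this (by linarith)))
    _ = Real.exp (T.card * (2 / x)) := by rw [Finset.prod_const, ← Real.exp_nat_mul]
    _ ≤ _ := by
      rw [Real.exp_le_exp, le_div_iff₀ hlogx]
      calc T.card * (2 / x) * Real.log x = (2 / x) * (T.card * Real.log x) := by ring
        _ ≤ (2 / x) * (x * Real.log 4) := by gcongr
        _ = _ := by field_simp

theorem half_log_sq_le_sum_siftingPrimes {x η : ℝ} (hx : 5 ≤ x) {R : ℕ} (hR : 1 ≤ R) {m : ℤ}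
    (hm : m ≠ 0) (hm4 : (m.natAbs : ℝ) ≤ 4 ^ x)
    (hprod : ∏ p ∈ (Finset.range (⌊x⌋₊ + 1)).filter Nat.Prime, (1 - 1 / p : ℝ)⁻¹ ≤
      Real.exp (Real.eulerMascheroniConstant + η) * Real.log x)
    (hη : 2 * Real.log 4 / Real.log x ≤ η) :
    Real.log R ^ 2 / 2 ≤ (Real.exp (Real.eulerMascheroniConstant + 2 * η) * Real.log x) ^ 2 *
      ∑ A ∈ primeSubsets (siftingPrimes ⌊x⌋₊ R m) R, ∏ p ∈ A, (2 / p : ℝ) / (1 - 2 / p) := by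
  have h5 : 5 ≤ ⌊x⌋₊ := Nat.le_floor (by exact_mod_cast hx)
  set E₁ := (Finset.range (⌊x⌋₊ + 1)).filter Nat.Prime with hE₁
  set E₂ := m.natAbs.primeFactors.filter fun p => ⌊x⌋₊ < p with hE₂
  have hmem₁ : ∀ p, p ∈ E₁ ↔ p ≤ ⌊x⌋₊ ∧ p.Prime := fun p => by simp [hE₁]
  have hmem₂ : ∀ p, p ∈ E₂ ↔ (p.Prime ∧ (p : ℤ) ∣ m) ∧ ⌊x⌋₊ < p := fun p => by
    simp [hE₂, hm, Int.natCast_dvd]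
  have hdisj : Disjoint E₁ E₂ := Finset.disjoint_left.2 fun p h₁ h₂ => by
    have := ((hmem₁ p).1 h₁).1
    have := ((hmem₂ p).1 h₂).2
    omega
  have hprime : ∀ p ∈ E₁ ∪ E₂, p.Prime := fun p hp => by
    rcases Finset.mem_union.1 hp with h | h
    · exact ((hmem₁ p).1 h).2
    · exact ((hmem₂ p).1 h).1.1
  have hsieve := half_log_sq_le_selberg_sum (E := E₁ ∪ E₂) (P := siftingPrimes ⌊x⌋₊ R m) hprime
    (fun p hp => by
      have := mem_siftingPrimes.1 hp
      exact ⟨this.2.1, by omega⟩)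
    (Finset.disjoint_left.2 fun p hp h => by
      have hp' := mem_siftingPrimes.1 hp
      rcases Finset.mem_union.1 h with h | h
      · have := ((hmem₁ p).1 h).1
        omega
      · exact hp'.2.2.2 ((hmem₂ p).1 h).1.2) hR
    (fun p hp hpR => by
      rw [Finset.mem_union, Finset.mem_union, mem_siftingPrimes, hmem₁, hmem₂]
      by_cases h₁ : p ≤ ⌊x⌋₊
      · exact Or.inr (Or.inl ⟨h₁, hp⟩)
      · by_cases h₂ : (p : ℤ) ∣ m
        · exact Or.inr (Or.inr ⟨⟨hp, h₂⟩, by omega⟩)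
        · exact Or.inl ⟨hpR, hp, by omega, h₂⟩)
  have hE₂prod : ∏ p ∈ E₂, (1 - 1 / p : ℝ)⁻¹ ≤ Real.exp η := by
    refine (prod_large_primes_inv_le (by linarith) (fun p hp => ?_) ?_).trans
      (Real.exp_le_exp.2 hη)
    · exact (Nat.floor_lt (by linarith)).1 ((hmem₂ p).1 hp).2
    · refine le_trans ?_ hm4
      have h₁ : ∏ p ∈ E₂, p ∣ m.natAbs :=
        (Finset.prod_dvd_prod_of_subset _ _ _ (Finset.filter_subset _ _)).trans
          (Nat.prod_primeFactors_dvd _)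
      exact_mod_cast Nat.le_of_dvd (Int.natAbs_pos.2 hm) h₁
  have hnonneg : ∀ E : Finset ℕ, 0 ≤ ∏ p ∈ E, (1 - 1 / p : ℝ)⁻¹ := fun E =>
    Finset.prod_nonneg fun p _ => inv_nonneg.2 (sub_nonneg.2 (by
      rw [one_div]
      exact Nat.cast_inv_le_one p))
  have hE : ∏ p ∈ E₁ ∪ E₂, (1 - 1 / p : ℝ)⁻¹ ≤
      Real.exp (Real.eulerMascheroniConstant + 2 * η) * Real.log x := by
    rw [Finset.prod_union hdisj]
    refine (mul_le_mul hprod hE₂prod (hnonneg _) ((hnonneg _).trans hprod)).trans (le_of_eq ?_)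
    rw [mul_right_comm, ← Real.exp_add]
    ring_nf
  refine hsieve.trans (mul_le_mul_of_nonneg_right (pow_le_pow_left₀ (hnonneg _) hE 2) ?_)
  refine Finset.sum_nonneg fun A hA => Finset.prod_nonneg fun p hp => ?_
  have hp' := mem_siftingPrimes.1 (Finset.mem_powerset.1 (Finset.mem_filter.1 hA).1 hp)
  have hp2 : (2 : ℝ) ≤ p := by exact_mod_cast hp'.2.1.two_le
  exact div_nonneg (by positivity) (sub_nonneg.2 (div_le_one_of_le₀ hp2 (by positivity)))

theorem eventually_log_floor_rpow {δ : ℝ} (hδ : 0 < δ) (hδ' : δ < 1 / 8) :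
    ∀ᶠ Z : ℝ in Filter.atTop, 1 ≤ ⌊Z ^ (1 / 2 - δ)⌋₊ ∧
      (1 / 2 - 2 * δ) * Real.log Z ≤ Real.log ⌊Z ^ (1 / 2 - δ)⌋₊ := by
  filter_upwards [(tendsto_rpow_atTop (by linarith : 0 < 1 / 2 - δ)).eventually_ge_atTop 2,
    (tendsto_rpow_atTop hδ).eventually_ge_atTop 2, Filter.eventually_gt_atTop 0] with Z h₁ h₂ hZ
  have hfloor : 1 ≤ ⌊Z ^ (1 / 2 - δ)⌋₊ := Nat.le_floor (by push_cast; linarith)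
  refine ⟨hfloor, ?_⟩
  rw [← Real.log_rpow hZ]
  refine Real.log_le_log (by positivity) ?_
  have hmul : Z ^ (1 / 2 - δ) = Z ^ (1 / 2 - 2 * δ) * Z ^ δ := by
    rw [← Real.rpow_add hZ]
    ring_nf
  have h₃ := Nat.lt_floor_add_one (Z ^ (1 / 2 - δ))
  have h₄ : 0 < Z ^ (1 / 2 - 2 * δ) := by positivity
  nlinarith

theorem sieve_remainder_le {δ Z : ℝ} {R : ℕ} (hδ : 0 < δ) (hZ : 1 ≤ Z)
    (hR : (R : ℝ) ≤ Z ^ (1 / 2 - δ)) :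
    (R : ℝ) + (R * (R : ℝ) ^ δ) ^ 2 ≤ 2 * Z ^ (1 - δ) := by
  have hZ0 : 0 < Z := by linarith
  have h₁ : (R : ℝ) ≤ Z ^ (1 - δ) :=
    hR.trans (Real.rpow_le_rpow_of_exponent_le hZ (by linarith))
  have h₂ : (R * (R : ℝ) ^ δ) ^ 2 ≤ Z ^ (1 - δ) := by
    calc (R * (R : ℝ) ^ δ) ^ 2 ≤ (Z ^ (1 / 2 - δ) * (Z ^ (1 / 2 - δ)) ^ δ) ^ 2 := by gcongr
      _ = Z ^ (((1 / 2 - δ) + (1 / 2 - δ) * δ) * (2 : ℕ)) := by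
        rw [← Real.rpow_mul hZ0.le, ← Real.rpow_add hZ0, Real.rpow_mul_natCast hZ0.le]
      _ ≤ Z ^ (1 - δ) := by
        refine Real.rpow_le_rpow_of_exponent_le hZ ?_
        push_cast
        nlinarith
  linarith

theorem exists_sieve_exponent {ε : ℝ} (hε : 0 < ε) :
    ∃ δ : ℝ, 0 < δ ∧ δ < 1 / 8 ∧
      8 * Real.exp (2 * Real.eulerMascheroniConstant + 4 * δ) / (1 - 4 * δ) ^ 2 ≤
        8 * Real.exp (2 * Real.eulerMascheroniConstant) + ε / 2 := by
  have hcont : ContinuousAt (fun δ : ℝ =>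
      8 * Real.exp (2 * Real.eulerMascheroniConstant + 4 * δ) / (1 - 4 * δ) ^ 2) 0 :=
    ContinuousAt.div (by fun_prop) (by fun_prop) (by norm_num)
  have hlim := hcont.tendsto.mono_left (nhdsWithin_le_nhds (s := Set.Ioi 0))
  have hev := hlim.eventually (gt_mem_nhds (a := 8 * Real.exp
    (2 * Real.eulerMascheroniConstant) + ε / 2) (by simpa using hε))
  obtain ⟨δ, h, hδ⟩ := (hev.and (Ioo_mem_nhdsGT (by norm_num : (0 : ℝ) < 1 / 8))).exists
  exact ⟨δ, hδ.1, hδ.2, h.le⟩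

theorem primorialBelow_pos (x : ℝ) : 0 < primorialBelow x :=
  Finset.prod_pos fun _ hp => (Finset.mem_filter.1 hp).2.pos

theorem prime_dvd_primorialBelow_iff {x : ℝ} {p : ℕ} (hp : p.Prime) :
    p ∣ primorialBelow x ↔ p ≤ ⌊x⌋₊ := by
  constructor
  · intro h
    obtain ⟨q, hq, hpq⟩ := (hp.prime.dvd_finsetProd_iff _).1 h
    rw [Finset.mem_filter, Finset.mem_range] at hq
    rw [(Nat.prime_dvd_prime_iff_eq hp hq.2).1 hpq]
    omega
  · intro h
    exact Finset.dvd_prod_of_mem _ (Finset.mem_filter.2 ⟨Finset.mem_range.2 (by omega), hp⟩)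

theorem primorialBelow_le_four_rpow {x : ℝ} (hx : 0 ≤ x) : (primorialBelow x : ℝ) ≤ 4 ^ x := by
  have h : primorialBelow x ≤ 4 ^ ⌊x⌋₊ := primorial_le_four_pow _
  calc (primorialBelow x : ℝ) ≤ ((4 ^ ⌊x⌋₊ : ℕ) : ℝ) := by exact_mod_cast h
    _ = (4 : ℝ) ^ (⌊x⌋₊ : ℝ) := by rw [Real.rpow_natCast]; norm_cast
    _ ≤ 4 ^ x := Real.rpow_le_rpow_of_exponent_le (by norm_num) (Nat.floor_le hx)

theorem exists_le_primorialBelow_div (M : ℕ) :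
    ∃ x₀ : ℝ, ∀ x : ℝ, x₀ ≤ x → ∀ B : ℕ, (B = 1 ∨ (B.Prime ∧ (B : ℝ) ≤ x)) →
      0 < primorialBelow x / B ∧ primorialBelow x / B ∣ primorialBelow x ∧
        M ≤ primorialBelow x / B := by
  obtain ⟨q₁, hMq₁, hq₁⟩ := Nat.exists_infinite_primes M
  obtain ⟨q₂, hq₁₂, hq₂⟩ := Nat.exists_infinite_primes (q₁ + 1)
  refine ⟨q₂, fun x hx B hB => ?_⟩
  have hdvd : B ∣ primorialBelow x := by
    rcases hB with rfl | ⟨hB, hBx⟩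
    · exact one_dvd _
    · exact (prime_dvd_primorialBelow_iff hB).2 (Nat.le_floor hBx)
  have hpos := Nat.div_pos (Nat.le_of_dvd (primorialBelow_pos x) hdvd)
    (Nat.pos_of_dvd_of_pos hdvd (primorialBelow_pos x))
  refine ⟨hpos, Nat.div_dvd_of_dvd hdvd, ?_⟩
  have hlarge : ∀ q : ℕ, q.Prime → q ≤ q₂ → M ≤ q → q ≠ B → M ≤ primorialBelow x / B := by
    intro q hq hqq₂ hMq hqB
    have hqx : q ∣ primorialBelow x := (prime_dvd_primorialBelow_iff hq).2
      (Nat.le_floor (le_trans (by exact_mod_cast hqq₂) hx))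
    rw [← Nat.div_mul_cancel hdvd] at hqx
    have hndvd : ¬ q ∣ B := by
      rcases hB with rfl | ⟨hB, -⟩
      · exact hq.one_lt.ne' ∘ Nat.dvd_one.1
      · exact fun h => hqB ((Nat.prime_dvd_prime_iff_eq hq hB).1 h)
    exact hMq.trans (Nat.le_of_dvd hpos ((hq.dvd_mul.1 hqx).resolve_right hndvd))
  by_cases h : q₁ = B
  · exact hlarge q₂ hq₂ le_rfl (by omega) (by omega)
  · exact hlarge q₁ hq₁ (by omega) hMq₁ h

/-- Upper bound sieve estimate: for `P = P(x)/B₀` with `B₀` either `1` or a prime in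
`[log x, x]`, `Z ≥ P^D` and distinct `a, b ∈ [P]`, the number of `z ∈ [Z]` with both
`Pz + a` and `Pz + b` prime is at most `(8e^{2γ} + ε)·(log x / log Z)²·Z`. -/
theorem twin_values_upper_bound (D ε : ℝ) (hD : 0 < D) (hε : 0 < ε) :
    ∃ x₀ : ℝ, ∀ x : ℝ, x₀ ≤ x → ∀ B₀ : ℕ,
      (B₀ = 1 ∨ (Nat.Prime B₀ ∧ Real.log x ≤ (B₀ : ℝ) ∧ (B₀ : ℝ) ≤ x)) →
      (let P : ℕ := primorialBelow x / B₀
      ∀ Z : ℝ, (P : ℝ) ^ D ≤ Z →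
        ∀ a b : ℤ, 1 ≤ a → a ≤ (P : ℤ) → 1 ≤ b → b ≤ (P : ℤ) → a ≠ b →
          (({z : ℤ | 1 ≤ z ∧ (z : ℝ) ≤ Z ∧ Prime ((P : ℤ) * z + a) ∧
              Prime ((P : ℤ) * z + b)}.ncard : ℝ))
            ≤ (8 * Real.exp (2 * Real.eulerMascheroniConstant) + ε) *
              (Real.log x / Real.log Z) ^ 2 * Z) := by
  obtain ⟨δ, hδ, hδ8, hδε⟩ := exists_sieve_exponent hε
  obtain ⟨Z₀, hZ₀⟩ := Filter.eventually_atTop.1 (((eventually_log_floor_rpow hδ hδ8).and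
    ((isLittleO_log_rpow_rpow_atTop 2 hδ).bound (by positivity : 0 < ε / 4))).and
    (Filter.eventually_gt_atTop 1))
  obtain ⟨M, hM⟩ := Filter.eventually_atTop.1
    (((tendsto_rpow_atTop hD).comp tendsto_natCast_atTop_atTop).eventually_ge_atTop Z₀)
  obtain ⟨x₁, hx₁⟩ := exists_le_primorialBelow_div M
  obtain ⟨x₂, hx₂⟩ := Filter.eventually_atTop.1 ((((eventually_prod_primes_inv_le hδ).and
    ((tendsto_const_nhds.div_atTop Real.tendsto_log_atTop).eventually
      (ge_mem_nhds hδ : ∀ᶠ y in nhds 0, y ≤ δ))).and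
    ((tendsto_rpow_atTop hδ).eventually_ge_atTop 4)).and
    (Real.tendsto_log_atTop.eventually_ge_atTop 1))
  refine ⟨max (max x₁ x₂) 5, fun x hx B₀ hB₀ => ?_⟩
  have hx5 : 5 ≤ x := (le_max_right _ _).trans hx
  obtain ⟨⟨⟨hmertens, hlog4⟩, hx4⟩, hlogx⟩ :=
    hx₂ x (((le_max_right _ _).trans (le_max_left _ _)).trans hx)
  obtain ⟨hP0, hPdvd, hMP⟩ := hx₁ x (((le_max_left _ _).trans (le_max_left _ _)).trans hx) B₀
    (hB₀.imp_right fun h => ⟨h.1, h.2.2⟩)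
  intro P Z hZ a b ha haP hb hbP hab
  obtain ⟨⟨⟨hR1, hlogR⟩, hlogZ⟩, hZ1⟩ := hZ₀ Z ((hM P hMP).trans hZ)
  have hZ0 : 0 < Z := one_pos.trans hZ1
  have hlogZ0 : 0 < Real.log Z := Real.log_pos hZ1
  set R := ⌊Z ^ (1 / 2 - δ)⌋₊ with hR
  set S := {z : ℤ | 1 ≤ z ∧ (z : ℝ) ≤ Z ∧ Prime ((P : ℤ) * z + a) ∧
    Prime ((P : ℤ) * z + b)} with hS
  have hSmem : ∀ z ∈ S, 0 < z ∧ z ≤ ⌊Z⌋₊ ∧ Prime ((P : ℤ) * z + a) ∧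
      Prime ((P : ℤ) * z + b) := by
    rintro z ⟨hz1, hzZ, hz⟩
    refine ⟨by omega, ?_, hz⟩
    rw [Int.natCast_floor_eq_floor hZ0.le]
    exact Int.le_floor.2 hzZ
  have hfin : S.Finite := (Set.finite_Ioc (0 : ℤ) ⌊Z⌋₊).subset fun z hz =>
    ⟨(hSmem z hz).1, (hSmem z hz).2.1⟩
  have hcount := card_prime_pairs_le (X := ⌊x⌋₊) (Q := P) (R := R) (N := ⌊Z⌋₊) hδ.le
    (Nat.le_floor (by push_cast; linarith only [hx5]))
    (fun p hp => hx4.trans (Real.rpow_le_rpow (by linarith only [hx5])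
      ((Nat.floor_lt (by linarith only [hx5])).1 hp).le hδ.le)) hP0
    (fun p hp hxp h =>
      hxp.not_ge ((prime_dvd_primorialBelow_iff hp).1 (h.trans hPdvd))) ha hb hR1
    hfin.toFinset (fun z hz => hSmem z (hfin.mem_toFinset.1 hz))
  have habs : ((a - b).natAbs : ℝ) ≤ 4 ^ x := by
    have h₁ : (a - b).natAbs ≤ P := by omega
    have h₂ : P ≤ primorialBelow x := Nat.le_of_dvd (primorialBelow_pos x) hPdvd
    exact le_trans (by exact_mod_cast h₁.trans h₂) (primorialBelow_le_four_rpow (by linarith only [hx5]))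
  have hL := half_log_sq_le_sum_siftingPrimes (R := R) hx5 hR1 (sub_ne_zero.2 hab) habs
    hmertens hlog4
  set L := ∑ A ∈ primeSubsets (siftingPrimes ⌊x⌋₊ R (a - b)) R,
    ∏ p ∈ A, (2 / p : ℝ) / (1 - 2 / p) with hLdef
  set V := Real.exp (Real.eulerMascheroniConstant + 2 * δ) * Real.log x with hV
  have hV0 : 0 < V := by positivity
  have hW0 : 0 < (1 / 2 - 2 * δ) * Real.log Z := mul_pos (by linarith only [hδ8]) hlogZ0
  have hWL : ((1 / 2 - 2 * δ) * Real.log Z) ^ 2 / 2 ≤ V ^ 2 * L := by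
    refine le_trans ?_ hL
    gcongr
  have hL0 : 0 < L := by
    have : 0 < V ^ 2 * L := lt_of_lt_of_le (by positivity) hWL
    exact pos_of_mul_pos_right this (by positivity)
  have hmain : (⌊Z⌋₊ : ℝ) / L ≤ (8 * Real.exp (2 * Real.eulerMascheroniConstant) + ε / 2) *
      (Real.log x / Real.log Z) ^ 2 * Z := by
    have hδ4 : 0 < 1 - 4 * δ := by linarith only [hδ8]
    calc (⌊Z⌋₊ : ℝ) / L ≤ Z / L := by gcongr; exact Nat.floor_le hZ0.le
      _ ≤ Z * (2 * V ^ 2 / ((1 / 2 - 2 * δ) * Real.log Z) ^ 2) := by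
        rw [div_eq_mul_inv]
        refine mul_le_mul_of_nonneg_left ?_ hZ0.le
        rw [inv_eq_one_div, div_le_div_iff₀ hL0 (by positivity)]
        linarith only [hWL]
      _ = 8 * Real.exp (2 * Real.eulerMascheroniConstant + 4 * δ) / (1 - 4 * δ) ^ 2 *
          (Real.log x / Real.log Z) ^ 2 * Z := by
        have hexp : Real.exp (2 * Real.eulerMascheroniConstant + 4 * δ) =
            Real.exp (Real.eulerMascheroniConstant + 2 * δ) ^ 2 := by
          rw [← Real.exp_nat_mul]
          push_cast
          ring_nf
        rw [hV, hexp, show (1 / 2 - 2 * δ) = (1 - 4 * δ) / 2 by ring]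
        field_simp
        ring
      _ ≤ _ := by gcongr
  have hrem : (R : ℝ) + (R * (R : ℝ) ^ δ) ^ 2 ≤
      ε / 2 * (Real.log x / Real.log Z) ^ 2 * Z := by
    refine (sieve_remainder_le hδ hZ1.le (Nat.floor_le (by positivity))).trans ?_
    rw [Real.norm_of_nonneg (by positivity), Real.norm_of_nonneg (by positivity),
      Real.rpow_two] at hlogZ
    have hmul : Z ^ (1 - δ) * Z ^ δ = Z := by
      rw [← Real.rpow_add hZ0, sub_add_cancel, Real.rpow_one]
    have hsq : Real.log Z ^ 2 * (2 * Z ^ (1 - δ)) ≤ ε / 2 * Z := by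
      calc Real.log Z ^ 2 * (2 * Z ^ (1 - δ)) ≤ ε / 4 * Z ^ δ * (2 * Z ^ (1 - δ)) := by gcongr
        _ = ε / 2 * (Z ^ (1 - δ) * Z ^ δ) := by ring
        _ = _ := by rw [hmul]
    have hlogx2 : 1 ≤ Real.log x ^ 2 := one_le_pow₀ hlogx
    calc 2 * Z ^ (1 - δ) ≤ ε / 2 * Z / Real.log Z ^ 2 := by
          rw [le_div_iff₀ (by positivity)]
          linarith only [hsq]
      _ ≤ ε / 2 * Z / Real.log Z ^ 2 * Real.log x ^ 2 :=
        le_mul_of_one_le_right (by positivity) hlogx2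
      _ = _ := by rw [div_pow]; ring
  rw [Set.ncard_eq_toFinset_card _ hfin]
  calc (hfin.toFinset.card : ℝ) ≤ _ := hcount
    _ ≤ (8 * Real.exp (2 * Real.eulerMascheroniConstant) + ε / 2) *
        (Real.log x / Real.log Z) ^ 2 * Z + ε / 2 * (Real.log x / Real.log Z) ^ 2 * Z :=
      (add_left_comm _ _ _).le.trans (add_le_add hmain hrem)
    _ = _ := by ring
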